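/- arXiv:1206.5440 — 9 statements merged into one kernel-verified Lean document; each statement's English description precedes it below -/
import Mathlib

section
/- Let n ≥ 1 and let φ : ℝⁿ → ℝ be continuously differentiable with compact support. Then lim_{t→∞} t · sup_{x∈ℝⁿ} |φ_t(x) − φ(x)| = 0; that is, ‖φ_t − φ‖_{L^∞(ℝⁿ)} = o(1/t) as t → ∞. -/
open MeasureTheory

/-- Rescaling the convolution against an approximate identity. -/
lemma integral_dilate_mul_eq {n : ℕ} (Ψ φ : EuclideanSpace ℝ (Fin n) → ℝ) {t : ℝ} (ht : 0 < t)
    (x : EuclideanSpace ℝ (Fin n)) :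
    ∫ y, (t ^ n * Ψ (t • (x - y))) * φ y = ∫ z, Ψ z * φ (x - t⁻¹ • z) := by
  have h1 := integral_sub_left_eq_self
    (fun y => (t ^ n * Ψ (t • y)) * φ (x - y)) (volume : Measure (EuclideanSpace ℝ (Fin n))) x
  have h2 := Measure.integral_comp_smul (volume : Measure (EuclideanSpace ℝ (Fin n)))
    (fun z => Ψ z * φ (x - t⁻¹ • z)) t
  simp only [sub_sub_cancel] at h1
  simp only [inv_smul_smul₀ ht.ne', finrank_euclideanSpace_fin, smul_eq_mul] at h2
  rw [h1]
  simp only [mul_assoc]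
  rw [integral_const_mul, h2, abs_of_pos (by positivity), mul_inv_cancel_left₀ (by positivity)]

/-- The first-order Taylor remainder of a compactly supported `C¹` function is uniformly `o(‖h‖)`. -/
lemma ContDiff.exists_forall_norm_taylor_remainder_le {E : Type*} [NormedAddCommGroup E]
    [NormedSpace ℝ E] {φ : E → ℝ} (hφ : ContDiff ℝ 1 φ) (hφc : HasCompactSupport φ)
    {ε : ℝ} (hε : 0 < ε) :
    ∃ δ > 0, ∀ x h : E, ‖h‖ < δ → ‖φ (x + h) - φ x - fderiv ℝ φ x h‖ ≤ ε * ‖h‖ := by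
  have huc : UniformContinuous (fderiv ℝ φ) :=
    (hφc.fderiv (𝕜 := ℝ)).uniformContinuous_of_continuous (hφ.continuous_fderiv one_ne_zero)
  obtain ⟨δ, hδ, H⟩ := Metric.uniformContinuous_iff.1 huc ε hε
  refine ⟨δ, hδ, fun x h hh => ?_⟩
  have := (convex_ball x δ).norm_image_sub_le_of_norm_fderiv_le' (𝕜 := ℝ) (f := φ)
    (φ := fderiv ℝ φ x) (C := ε) (x := x) (y := x + h)
    (fun y _ => (hφ.differentiable one_ne_zero) y)
    (fun y hy => by simpa [dist_eq_norm] using (H (a := y) (b := x) hy).le)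
    (Metric.mem_ball_self hδ) (by simpa using hh)
  simpa using this

/-- An even weight has vanishing first moments. -/
lemma integral_even_mul_linear_eq_zero {E : Type*} [NormedAddCommGroup E] [NormedSpace ℝ E]
    [MeasurableSpace E] [BorelSpace E] (μ : Measure E) [μ.IsNegInvariant] {Ψ : E → ℝ}
    (hΨ : ∀ x, Ψ (-x) = Ψ x) (L : E →L[ℝ] ℝ) : ∫ z, Ψ z * L z ∂μ = 0 := by
  have h := integral_neg_eq_self (fun z => Ψ z * L z) μ
  simp only [hΨ, map_neg, mul_neg, integral_neg] at h
  linarith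

/-- For `φ` continuously differentiable with compact support on `ℝⁿ`,
the mollifications `φ_t = Ψ_t * φ` satisfy `‖φ_t - φ‖_{L^∞} = o(1/t)` as `t → ∞`. -/
theorem stmt_0 (n : ℕ) (hn : 1 ≤ n)
    (Ψ : EuclideanSpace ℝ (Fin n) → ℝ)
    (hΨ_smooth : ContDiff ℝ (⊤ : ℕ∞) Ψ)
    (hΨ_nonneg : ∀ x, 0 ≤ Ψ x)
    (hΨ_radial : ∀ x y : EuclideanSpace ℝ (Fin n), ‖x‖ = ‖y‖ → Ψ x = Ψ y)
    (hΨ_supp : Function.support Ψ ⊆ Metric.closedBall 0 1)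
    (hΨ_int : ∫ x, Ψ x = 1)
    (φ : EuclideanSpace ℝ (Fin n) → ℝ)
    (hφ : ContDiff ℝ 1 φ) (hφc : HasCompactSupport φ) :
    ∀ ε > 0, ∃ T : ℝ, ∀ t ≥ T, ∀ x : EuclideanSpace ℝ (Fin n),
      t * |(∫ y, (t ^ n * Ψ (t • (x - y))) * φ y) - φ x| ≤ ε := by
  intro ε hε
  obtain ⟨δ, hδ, H⟩ := hφ.exists_forall_norm_taylor_remainder_le hφc hε
  refine ⟨2 / δ, fun t ht x => ?_⟩
  have ht0 : 0 < t := lt_of_lt_of_le (by positivity) ht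
  have htδ : t⁻¹ < δ := by
    rw [ge_iff_le, div_le_iff₀ hδ] at ht
    rw [inv_lt_iff_one_lt_mul₀ ht0]
    linarith
  have hΨc : HasCompactSupport Ψ :=
    HasCompactSupport.of_support_subset_isCompact (isCompact_closedBall 0 1) hΨ_supp
  have hint : ∀ {g : EuclideanSpace ℝ (Fin n) → ℝ}, Continuous g →
      Integrable fun z => Ψ z * g z := fun hg =>
    (hΨ_smooth.continuous.mul hg).integrable_of_hasCompactSupport hΨc.mul_right
  have hφ_cont := hφ.continuous
  set L : EuclideanSpace ℝ (Fin n) →L[ℝ] ℝ := fderiv ℝ φ x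
  have hL : ∫ z, Ψ z * L (-(t⁻¹ • z)) = 0 := by
    simpa using integral_even_mul_linear_eq_zero volume
      (fun z => hΨ_radial _ _ (norm_neg z)) (-(t⁻¹ • L))
  have key : (∫ y, (t ^ n * Ψ (t • (x - y))) * φ y) - φ x =
      ∫ z, Ψ z * (φ (x + -(t⁻¹ • z)) - φ x - L (-(t⁻¹ • z))) := by
    have i₁ := hint (g := fun z => φ (x + -(t⁻¹ • z))) (by fun_prop)
    have i₂ := hint (g := fun _ => φ x) (by fun_prop)
    have i₃ := hint (g := fun z => L (-(t⁻¹ • z))) (by fun_prop)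
    simp only [mul_sub]
    rw [integral_sub (by exact i₁.sub i₂) i₃, integral_sub i₁ i₂, hL, integral_mul_const, hΨ_int,
      integral_dilate_mul_eq Ψ φ ht0]
    simp [sub_eq_add_neg]
  have hbound : ‖∫ z, Ψ z * (φ (x + -(t⁻¹ • z)) - φ x - L (-(t⁻¹ • z)))‖ ≤
      ∫ z, Ψ z * (ε * t⁻¹) := by
    refine norm_integral_le_of_norm_le (hint continuous_const) (.of_forall fun z => ?_)
    rw [norm_mul, Real.norm_of_nonneg (hΨ_nonneg z)]
    by_cases hz : Ψ z = 0
    · simp [hz]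
    have hz1 : ‖z‖ ≤ 1 := by simpa using hΨ_supp hz
    have hh : ‖-(t⁻¹ • z)‖ ≤ t⁻¹ := by
      rw [norm_neg, norm_smul, Real.norm_of_nonneg (by positivity)]
      exact mul_le_of_le_one_right (by positivity) hz1
    exact mul_le_mul_of_nonneg_left ((H x _ (hh.trans_lt htδ)).trans (by gcongr)) (hΨ_nonneg z)
  rw [integral_mul_const, hΨ_int, one_mul, Real.norm_eq_abs, ← key] at hbound
  calc _ ≤ t * (ε * t⁻¹) := by gcongr
    _ = ε := by field_simp
end

section
/- Let n ≥ 1 and let φ : ℝⁿ → ℝ be continuously differentiable with compact support. Then for all indices 1 ≤ i, j ≤ n, lim_{t→∞} t^{−1} · sup_{x∈ℝⁿ} |∂_i∂_j φ_t(x)| = 0; that is, ‖D²φ_t‖_{L^∞(ℝⁿ)} = o(t) as t → ∞. -/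
open MeasureTheory

section

variable {E : Type*} [NormedAddCommGroup E] [NormedSpace ℝ E] [FiniteDimensional ℝ E]
  [MeasurableSpace E] [BorelSpace E] {μ : Measure E} [μ.IsAddHaarMeasure]

/-- Directional differentiation of a convolution falls on the second factor. -/
lemma fderiv_integral_mul_sub_apply {f g : E → ℝ} (hf : Continuous f)
    (hg : ContDiff ℝ 1 g) (hgc : HasCompactSupport g) (x e : E) :
    fderiv ℝ (fun y => ∫ w, f w * g (y - w) ∂μ) x e =
      ∫ w, f w * fderiv ℝ g (x - w) e ∂μ := by
  have h := hgc.hasFDerivAt_convolution_right (ContinuousLinearMap.mul ℝ ℝ)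
    (hf.locallyIntegrable (μ := μ)) hg x
  have h2 := convolution_precompR_apply (ContinuousLinearMap.mul ℝ ℝ)
    (hf.locallyIntegrable (μ := μ)) (hgc.fderiv ℝ) (hg.continuous_fderiv one_ne_zero) x e
  exact (congrArg (fun D : E →L[ℝ] ℝ => D e) h.fderiv).trans h2

/-- The integral of a directional derivative of a compactly supported function vanishes. -/
lemma integral_fderiv_apply_eq_zero {k : E → ℝ} (hk : ContDiff ℝ 1 k)
    (hkc : HasCompactSupport k) (e : E) : ∫ v, fderiv ℝ k v e ∂μ = 0 := by
  have hi : Integrable (fun v => fderiv ℝ k v e) μ :=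
    ((hk.continuous_fderiv one_ne_zero).clm_apply continuous_const).integrable_of_hasCompactSupport
      (hkc.fderiv_apply ℝ e)
  have hki : Integrable k μ := hk.continuous.integrable_of_hasCompactSupport hkc
  simpa using integral_mul_fderiv_eq_neg_fderiv_mul_of_integrable (μ := μ) (v := e)
    (f := fun _ => (1 : ℝ)) (g := k) (by simp) (by simpa using hi) (by simpa using hki)
    (by simp) (fun x _ => hk.differentiable one_ne_zero x)

/-- The convolution of `f` with a directional derivative of a bump `k` of radius `r` is controlled
by the oscillation of `f` at scale `r`. -/
lemma abs_integral_mul_fderiv_sub_le {f k : E → ℝ} (hf : Continuous f) (hk : ContDiff ℝ 1 k)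
    {r η : ℝ} (hkr : Function.support k ⊆ Metric.closedBall 0 r) (x e : E)
    (hη : ∀ v : E, ‖v‖ ≤ r → |f (x - v) - f x| ≤ η) :
    |∫ w, f w * fderiv ℝ k (x - w) e ∂μ| ≤ η * ∫ v, |fderiv ℝ k v e| ∂μ := by
  have hts : tsupport k ⊆ Metric.closedBall 0 r :=
    closure_minimal hkr Metric.isClosed_closedBall
  have hkc : HasCompactSupport k :=
    (ProperSpace.isCompact_closedBall 0 r).of_isClosed_subset (isClosed_tsupport k) hts
  have hDc : Continuous (fun v => fderiv ℝ k v e) :=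
    (hk.continuous_fderiv one_ne_zero).clm_apply continuous_const
  have hDs : HasCompactSupport (fun v => fderiv ℝ k v e) := hkc.fderiv_apply ℝ e
  have hD : Integrable (fun v => fderiv ℝ k v e) μ := hDc.integrable_of_hasCompactSupport hDs
  have hfD : Integrable (fun v => f (x - v) * fderiv ℝ k v e) μ :=
    Continuous.integrable_of_hasCompactSupport (by fun_prop) hDs.mul_left
  have hrw : ∫ w, f w * fderiv ℝ k (x - w) e ∂μ =
      ∫ v, (f (x - v) - f x) * fderiv ℝ k v e ∂μ := by
    rw [← integral_sub_left_eq_self _ μ x]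
    simp_rw [sub_sub_self, sub_mul]
    rw [integral_sub hfD (hD.const_mul _), integral_const_mul,
      integral_fderiv_apply_eq_zero hk hkc, mul_zero, sub_zero]
  rw [hrw, ← integral_const_mul, ← Real.norm_eq_abs]
  refine norm_integral_le_of_norm_le (hD.abs.const_mul η) (.of_forall fun v => ?_)
  rw [norm_mul, Real.norm_eq_abs, Real.norm_eq_abs]
  by_cases hv : ‖v‖ ≤ r
  · exact mul_le_mul_of_nonneg_right (hη v hv) (abs_nonneg _)
  · have h0 : fderiv ℝ k v = 0 := by
      by_contra h
      exact hv (mem_closedBall_zero_iff.1 (hts (support_fderiv_subset ℝ (f := k) h)))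
    simp [h0]

/-- The `L¹` norm of a directional derivative scales linearly under `L¹`-normalised dilation. -/
lemma integral_abs_fderiv_dilation {Ψ : E → ℝ} {t : ℝ} (ht : 0 < t) (e : E) :
    ∫ v, |fderiv ℝ (fun z => t ^ Module.finrank ℝ E * Ψ (t • z)) v e| ∂μ =
      t * ∫ v, |fderiv ℝ Ψ v e| ∂μ := by
  have h (v : E) : |fderiv ℝ (fun z => t ^ Module.finrank ℝ E * Ψ (t • z)) v e| =
      t ^ Module.finrank ℝ E * t * |fderiv ℝ Ψ (t • v) e| := by
    have : fderiv ℝ (fun z => t ^ Module.finrank ℝ E * Ψ (t • z)) v =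
        t ^ Module.finrank ℝ E • t • fderiv ℝ Ψ (t • v) := by
      rw [← fderiv_comp_smul]
      exact congrFun (fderiv_const_smul_field (t ^ Module.finrank ℝ E)) v
    rw [this]
    simp only [smul_apply, smul_eq_mul, abs_mul, abs_of_pos ht,
      abs_of_pos (pow_pos ht _), mul_assoc]
  simp_rw [h]
  rw [integral_const_mul, Measure.integral_comp_smul μ (fun v => |fderiv ℝ Ψ v e|) t,
    abs_of_pos (by positivity), smul_eq_mul]
  field_simp

end

/-- For `φ` continuously differentiable with compact support on `ℝⁿ`,
the second derivatives of the mollifications `φ_t = Ψ_t * φ` satisfy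
`‖D²φ_t‖_{L^∞} = o(t)` as `t → ∞`. -/
theorem stmt_1 (n : ℕ) (hn : 1 ≤ n)
    (Ψ : EuclideanSpace ℝ (Fin n) → ℝ)
    (hΨ_smooth : ContDiff ℝ (⊤ : ℕ∞) Ψ)
    (hΨ_nonneg : ∀ x, 0 ≤ Ψ x)
    (hΨ_radial : ∀ x y : EuclideanSpace ℝ (Fin n), ‖x‖ = ‖y‖ → Ψ x = Ψ y)
    (hΨ_supp : Function.support Ψ ⊆ Metric.closedBall 0 1)
    (hΨ_int : ∫ x, Ψ x = 1)
    (φ : EuclideanSpace ℝ (Fin n) → ℝ)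
    (hφ : ContDiff ℝ 1 φ) (hφc : HasCompactSupport φ) :
    ∀ ε > 0, ∃ T : ℝ, ∀ t ≥ T, ∀ (x : EuclideanSpace ℝ (Fin n)) (i j : Fin n),
      t⁻¹ * |fderiv ℝ
          (fun z => fderiv ℝ (fun y => ∫ w, (t ^ n * Ψ (t • (y - w))) * φ w) z
            (EuclideanSpace.single j 1))
          x (EuclideanSpace.single i 1)| ≤ ε := by
  intro ε hε
  set M : ℝ := ∑ i : Fin n, ∫ v, |fderiv ℝ Ψ v (EuclideanSpace.single i 1)|
  have hM0 : 0 ≤ M := Finset.sum_nonneg fun i _ => integral_nonneg fun v => abs_nonneg _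
  have hDφ : UniformContinuous (fderiv ℝ φ) :=
    (hφc.fderiv ℝ).uniformContinuous_of_continuous (hφ.continuous_fderiv one_ne_zero)
  obtain ⟨δ, hδ, hosc⟩ := Metric.uniformContinuous_iff.1 hDφ (ε / (M + 1)) (by positivity)
  refine ⟨2 / δ, fun t htT x i j => ?_⟩
  have ht : 0 < t := lt_of_lt_of_le (by positivity) htT
  have htδ : t⁻¹ < δ := by
    rw [inv_lt_comm₀ ht hδ]
    refine lt_of_lt_of_le ?_ htT
    rw [inv_eq_one_div]
    gcongr
    norm_num
  set k : EuclideanSpace ℝ (Fin n) → ℝ := fun z => t ^ n * Ψ (t • z) with hkdef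
  have hk : ContDiff ℝ 1 k :=
    contDiff_const.mul ((hΨ_smooth.of_le (by exact_mod_cast le_top)).comp
      (contDiff_const_smul t))
  have hkr : Function.support k ⊆ Metric.closedBall 0 t⁻¹ := by
    intro z hz
    have h1 := hΨ_supp (show t • z ∈ Function.support Ψ from right_ne_zero_of_mul hz)
    rw [mem_closedBall_zero_iff, norm_smul, Real.norm_of_nonneg ht.le] at h1
    rw [mem_closedBall_zero_iff, ← one_div, le_div_iff₀' ht]
    exact h1
  have hfirst : (fun z => fderiv ℝ (fun y => ∫ w, (t ^ n * Ψ (t • (y - w))) * φ w) z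
      (EuclideanSpace.single j 1)) =
      fun z => ∫ w, fderiv ℝ φ w (EuclideanSpace.single j 1) * k (z - w) := by
    have hswap : (fun y => ∫ w, (t ^ n * Ψ (t • (y - w))) * φ w) =
        fun y => ∫ w, k w * φ (y - w) := by
      funext y
      rw [← integral_sub_left_eq_self _ volume y]
      simp [hkdef]
    funext z
    rw [hswap, fderiv_integral_mul_sub_apply hk.continuous hφ hφc,
      ← integral_sub_left_eq_self _ volume z]
    simp [mul_comm]
  have hkc : HasCompactSupport k :=
    HasCompactSupport.of_support_subset_isCompact (ProperSpace.isCompact_closedBall 0 t⁻¹) hkr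
  have hf : Continuous fun w => fderiv ℝ φ w (EuclideanSpace.single j 1) :=
    (hφ.continuous_fderiv one_ne_zero).clm_apply continuous_const
  have hbound := abs_integral_mul_fderiv_sub_le (μ := volume) (η := ε / (M + 1)) hf hk hkr x
    (EuclideanSpace.single i 1) fun v hv => by
      have h1 : dist (x - v) x < δ := by
        rw [dist_eq_norm]
        simpa using hv.trans_lt htδ
      have h2 := hosc h1
      rw [dist_eq_norm] at h2
      rw [← sub_apply, ← Real.norm_eq_abs]
      refine (ContinuousLinearMap.le_opNorm _ _).trans ?_
      simpa using h2.le
  have hscale := integral_abs_fderiv_dilation (μ := volume) (Ψ := Ψ) ht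
    (EuclideanSpace.single i (1 : ℝ))
  rw [finrank_euclideanSpace_fin] at hscale
  have hle : ∫ v, |fderiv ℝ Ψ v (EuclideanSpace.single i 1)| ≤ M :=
    Finset.single_le_sum (f := fun i : Fin n =>
      ∫ v, |fderiv ℝ Ψ v (EuclideanSpace.single i 1)|)
      (fun i _ => integral_nonneg fun v => abs_nonneg _) (Finset.mem_univ i)
  rw [hfirst, fderiv_integral_mul_sub_apply hf hk hkc]
  rw [hscale] at hbound
  calc _ ≤ t⁻¹ * (ε / (M + 1) * (t * M)) := by
        refine mul_le_mul_of_nonneg_left (hbound.trans ?_) (by positivity)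
        gcongr
    _ = ε * (M / (M + 1)) := by field_simp
    _ ≤ ε := mul_le_of_le_one_right hε.le (by rw [div_le_one (by positivity)]; linarith)
end

section
/- Let n ≥ 1 and let φ : ℝⁿ → ℝ be continuous with compact support and satisfy ∫_{ℝⁿ} ‖ξ‖³ |𝓕φ(ξ)|² dξ < ∞. Then for every σ with 0 ≤ σ ≤ 3/2, lim_{t→∞} t^{3−2σ} ∫_{ℝⁿ} ‖ξ‖^{2σ} |𝓕φ_t(ξ) − 𝓕φ(ξ)|² dξ = 0. In particular ‖φ_t − φ‖_{L²(ℝⁿ)} = o(t^{−3/2}), ‖φ_t − φ‖_{H^{1,2}(ℝⁿ)} = o(t^{−1/2}), and ‖φ_t − φ‖_{H^{3/2,2}(ℝⁿ)} = o(1) as t → ∞. -/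
open MeasureTheory Filter
open scoped FourierTransform

section FourierDecay

variable {V : Type*} [NormedAddCommGroup V] [InnerProductSpace ℝ V] [FiniteDimensional ℝ V]
  [MeasurableSpace V] [BorelSpace V]

lemma norm_exp_neg_add_exp_sub_two_le (θ : ℝ) :
    ‖Complex.exp (((-θ : ℝ) : ℂ) * Complex.I) + Complex.exp ((θ : ℂ) * Complex.I) - 2‖ ≤ θ ^ 2 := by
  have h : Complex.exp (((-θ : ℝ) : ℂ) * Complex.I) + Complex.exp ((θ : ℂ) * Complex.I) - 2
      = ((2 * (Real.cos θ - 1) : ℝ) : ℂ) := by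
    push_cast
    rw [Complex.cos]
    ring
  rw [h, Complex.norm_real, Real.norm_eq_abs, abs_le]
  constructor
  · linarith [Real.one_sub_sq_div_two_le_cos (x := θ)]
  · nlinarith [Real.cos_le_one θ, sq_nonneg θ]

lemma integrable_exp_mul_I_smul {F : V → ℂ} (hF : Integrable F) {θ : V → ℝ}
    (hθ : Continuous θ) : Integrable fun x => Complex.exp ((θ x : ℂ) * Complex.I) • F x := by
  have hc : Continuous fun x => Complex.exp ((θ x : ℂ) * Complex.I) := by fun_prop
  refine hF.bdd_smul 1 hc.aestronglyMeasurable ?_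
  exact Eventually.of_forall fun x => (Complex.norm_exp_ofReal_mul_I _).le

/-- The Fourier transform of an even probability density supported in the ball of radius `r`
differs from `1` by at most `2 * (π * r * ‖ξ‖) ^ 2`. -/
lemma norm_fourier_sub_one_le_sq {f : V → ℝ} {r : ℝ} (hf : Integrable f) (hf0 : ∀ x, 0 ≤ f x)
    (heven : ∀ x, f (-x) = f x) (hsupp : Function.support f ⊆ Metric.closedBall 0 r)
    (hint : ∫ x, f x = 1) (ξ : V) :
    ‖𝓕 (fun x => (f x : ℂ)) ξ - 1‖ ≤ 2 * (Real.pi * r * ‖ξ‖) ^ 2 := by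
  set θ : V → ℝ := fun x => 2 * Real.pi * inner ℝ x ξ with hθ
  have hθc : Continuous θ := by fun_prop
  have hF : Integrable fun x => (f x : ℂ) := hf.ofReal
  have h1 : 𝓕 (fun x => (f x : ℂ)) ξ
      = ∫ x, Complex.exp (((-θ x : ℝ) : ℂ) * Complex.I) • (f x : ℂ) := by
    rw [Real.fourier_eq']
    simp only [hθ, neg_mul]
  have h2 : 𝓕 (fun x => (f x : ℂ)) ξ = ∫ x, Complex.exp ((θ x : ℂ) * Complex.I) • (f x : ℂ) := by
    rw [h1, ← integral_neg_eq_self]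
    simp only [hθ, heven, inner_neg_left, mul_neg, neg_neg]
  have h3 : (1 : ℂ) = ∫ x, (f x : ℂ) := by
    rw [integral_complex_ofReal, hint, Complex.ofReal_one]
  have hi1 : Integrable fun x => Complex.exp (((-θ x : ℝ) : ℂ) * Complex.I) • (f x : ℂ) :=
    integrable_exp_mul_I_smul hF hθc.neg
  have hi2 := integrable_exp_mul_I_smul hF hθc
  have key : 2 * (𝓕 (fun x => (f x : ℂ)) ξ - 1) = ∫ x,
      (Complex.exp (((-θ x : ℝ) : ℂ) * Complex.I) + Complex.exp ((θ x : ℂ) * Complex.I) - 2)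
        * (f x : ℂ) := by
    calc 2 * (𝓕 (fun x => (f x : ℂ)) ξ - 1)
        = 𝓕 (fun x => (f x : ℂ)) ξ + 𝓕 (fun x => (f x : ℂ)) ξ - 2 * 1 := by ring
      _ = (∫ x, Complex.exp (((-θ x : ℝ) : ℂ) * Complex.I) • (f x : ℂ))
          + (∫ x, Complex.exp ((θ x : ℂ) * Complex.I) • (f x : ℂ)) - 2 * ∫ x, (f x : ℂ) := by
        rw [← h1, ← h2, ← h3]
      _ = _ := by
        rw [← integral_const_mul, ← integral_add hi1 hi2,
          ← integral_sub (by exact hi1.add hi2) (hF.const_mul 2)]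
        congr 1 with x
        simp only [smul_eq_mul]
        ring
  have hbound : ‖2 * (𝓕 (fun x => (f x : ℂ)) ξ - 1)‖
      ≤ ∫ x, (2 * Real.pi * r * ‖ξ‖) ^ 2 * f x := by
    rw [key]
    refine norm_integral_le_of_norm_le (hf.const_mul _) (Eventually.of_forall fun x => ?_)
    rw [norm_mul, Complex.norm_real, Real.norm_of_nonneg (hf0 x)]
    by_cases hx : f x = 0
    · simp [hx]
    have hxr : ‖x‖ ≤ r := by simpa using hsupp (Function.mem_support.2 hx)
    refine mul_le_mul_of_nonneg_right ((norm_exp_neg_add_exp_sub_two_le _).trans ?_) (hf0 x)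
    refine sq_le_sq' ?_ ?_ <;> simp only [hθ]
    · have := neg_le_of_abs_le ((abs_real_inner_le_norm x ξ).trans
        (mul_le_mul_of_nonneg_right hxr (norm_nonneg ξ)))
      nlinarith [Real.pi_pos]
    · have := (real_inner_le_norm x ξ).trans (mul_le_mul_of_nonneg_right hxr (norm_nonneg ξ))
      nlinarith [Real.pi_pos]
  rw [integral_const_mul, hint, norm_mul, Complex.norm_ofNat] at hbound
  linarith

lemma norm_fourier_sub_one_le_two {f : V → ℝ} (hf0 : ∀ x, 0 ≤ f x) (hint : ∫ x, f x = 1) (ξ : V) :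
    ‖𝓕 (fun x => (f x : ℂ)) ξ - 1‖ ≤ 2 := by
  have h : ‖𝓕 (fun x => (f x : ℂ)) ξ‖ ≤ 1 := by
    refine (VectorFourier.norm_fourierIntegral_le_integral_norm _ _ _ _ _).trans_eq ?_
    simp only [Complex.norm_real, Real.norm_of_nonneg (hf0 _), hint]
  calc _ ≤ ‖𝓕 (fun x => (f x : ℂ)) ξ‖ + ‖(1 : ℂ)‖ := norm_sub_le _ _
    _ ≤ 2 := by rw [norm_one]; linarith

lemma continuous_fourier_of_integrable {F : V → ℂ} (hF : Integrable F) : Continuous (𝓕 F) :=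
  VectorFourier.fourierIntegral_continuous Real.continuous_fourierChar
    (innerSL ℝ).continuous₂ hF

lemma fourier_integral_sub_mul {f g : V → ℝ} (hf : Integrable f) (hg : Integrable g) (ξ : V) :
    𝓕 (fun x => ((∫ y, f (x - y) * g y : ℝ) : ℂ)) ξ
      = 𝓕 (fun x => (f x : ℂ)) ξ * 𝓕 (fun x => (g x : ℂ)) ξ := by
  have hf' : Integrable fun x => (f x : ℂ) := hf.ofReal
  have hg' : Integrable fun x => (g x : ℂ) := hg.ofReal
  rw [mul_comm, ← Real.fourier_mul_convolution_eq hg' hf']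
  refine congrFun (congrArg 𝓕 (funext fun x => ?_)) ξ
  rw [convolution_def, ← integral_complex_ofReal]
  simp [mul_comm]

end FourierDecay

/-- A quantity bounded by both `2` and `2 * π ^ 2 * (a / t) ^ 2` has square, weighted by
`t ^ (3 - 2σ) * a ^ (2σ)`, bounded by a multiple of `a ^ 3`. -/
lemma rpow_mul_rpow_mul_sq_le {σ t a N : ℝ} (hσ0 : 0 ≤ σ) (hσ : σ ≤ 3 / 2) (ht : 0 < t)
    (ha : 0 ≤ a) (hN0 : 0 ≤ N) (hN2 : N ≤ 2) (hN : N ≤ 2 * Real.pi ^ 2 * (a / t) ^ 2) :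
    t ^ (3 - 2 * σ) * a ^ (2 * σ) * N ^ 2 ≤ (2 * Real.pi ^ 2) ^ 2 * a ^ 3 := by
  have hη : 0 ≤ a / t := by positivity
  have hN' : N ^ 2 ≤ (2 * Real.pi ^ 2) ^ 2 * (a / t) ^ (3 - 2 * σ) := by
    rcases le_total (a / t) 1 with h | h
    · calc N ^ 2 ≤ (2 * Real.pi ^ 2 * (a / t) ^ 2) ^ 2 := by gcongr
        _ = (2 * Real.pi ^ 2) ^ 2 * (a / t) ^ (4 : ℝ) := by norm_cast; ring
        _ ≤ _ := by
          gcongr ?_ * ?_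
          exact Real.rpow_le_rpow_of_exponent_ge_of_imp hη h (by linarith) (by
            intro _ h4; linarith)
    · calc N ^ 2 ≤ (2 * Real.pi ^ 2) ^ 2 * 1 := by
            rw [mul_one]
            gcongr
            nlinarith [Real.pi_gt_three]
        _ ≤ _ := by
          gcongr
          exact Real.one_le_rpow h (by linarith)
  calc t ^ (3 - 2 * σ) * a ^ (2 * σ) * N ^ 2
      ≤ t ^ (3 - 2 * σ) * a ^ (2 * σ) * ((2 * Real.pi ^ 2) ^ 2 * (a / t) ^ (3 - 2 * σ)) := by
        gcongr
    _ = (2 * Real.pi ^ 2) ^ 2 * (a ^ (2 * σ) * a ^ (3 - 2 * σ)) := by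
        rw [Real.div_rpow ha ht.le]
        have := (Real.rpow_pos_of_pos ht (3 - 2 * σ)).ne'
        field_simp
    _ = (2 * Real.pi ^ 2) ^ 2 * a ^ 3 := by
        rw [← Real.rpow_add_of_nonneg ha (by linarith) (by linarith)]
        norm_num

lemma tendsto_rpow_mul_rpow_mul_sq {σ a : ℝ} {N : ℝ → ℝ} (hσ0 : 0 ≤ σ) (ha : 0 ≤ a)
    (hN0 : ∀ t, 0 ≤ N t) (hN : ∀ t > 0, N t ≤ 2 * Real.pi ^ 2 * (a / t) ^ 2) :
    Tendsto (fun t : ℝ => t ^ (3 - 2 * σ) * a ^ (2 * σ) * N t ^ 2) atTop (nhds 0) := by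
  have h0 : Tendsto (fun t : ℝ => t ^ (-(1 + 2 * σ)) * (a ^ (2 * σ) * (2 * Real.pi ^ 2 * a ^ 2) ^ 2))
      atTop (nhds 0) := by
    simpa using (tendsto_rpow_neg_atTop (y := 1 + 2 * σ) (by linarith)).mul_const
      (a ^ (2 * σ) * (2 * Real.pi ^ 2 * a ^ 2) ^ 2)
  refine tendsto_of_tendsto_of_tendsto_of_le_of_le' tendsto_const_nhds h0 ?_ ?_
  · filter_upwards [eventually_gt_atTop 0] with t ht
    positivity
  · filter_upwards [eventually_gt_atTop 0] with t ht
    have hpow : t ^ (3 - 2 * σ) = t ^ (-(1 + 2 * σ)) * t ^ 4 := by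
      rw [← Real.rpow_natCast t 4, ← Real.rpow_add ht]
      congr 1
      push_cast
      ring
    calc t ^ (3 - 2 * σ) * a ^ (2 * σ) * N t ^ 2
        ≤ t ^ (3 - 2 * σ) * a ^ (2 * σ) * (2 * Real.pi ^ 2 * (a / t) ^ 2) ^ 2 := by
          gcongr
          exacts [hN0 t, hN t ht]
      _ = _ := by
          rw [hpow]
          field_simp

/-- If `φ` is continuous with compact support and lies in `H^{3/2,2}(ℝⁿ)`,
then for `0 ≤ σ ≤ 3/2` one has `t^{3-2σ} ∫ ‖ξ‖^{2σ} |𝓕φ_t(ξ) - 𝓕φ(ξ)|² dξ → 0` as `t → ∞`;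
in particular `‖φ_t - φ‖_{L²} = o(t^{-3/2})`, `‖φ_t - φ‖_{H^{1,2}} = o(t^{-1/2})` and
`‖φ_t - φ‖_{H^{3/2,2}} = o(1)`. -/
theorem stmt_2 (n : ℕ) (hn : 1 ≤ n)
    (Ψ : EuclideanSpace ℝ (Fin n) → ℝ)
    (hΨ_smooth : ContDiff ℝ (⊤ : ℕ∞) Ψ)
    (hΨ_nonneg : ∀ x, 0 ≤ Ψ x)
    (hΨ_radial : ∀ x y : EuclideanSpace ℝ (Fin n), ‖x‖ = ‖y‖ → Ψ x = Ψ y)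
    (hΨ_supp : Function.support Ψ ⊆ Metric.closedBall 0 1)
    (hΨ_int : ∫ x, Ψ x = 1)
    (φ : EuclideanSpace ℝ (Fin n) → ℝ)
    (hφ : Continuous φ) (hφc : HasCompactSupport φ)
    (hφH : ∫⁻ ξ, ENNReal.ofReal (‖ξ‖ ^ 3 * ‖𝓕 (fun x => (φ x : ℂ)) ξ‖ ^ 2) ≠ ⊤)
    (σ : ℝ) (hσ0 : 0 ≤ σ) (hσ : σ ≤ 3 / 2) :
    Tendsto (fun t : ℝ => ∫⁻ ξ, ENNReal.ofReal
        (t ^ (3 - 2 * σ) * ‖ξ‖ ^ (2 * σ) *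
          ‖𝓕 (fun x => ((∫ y, (t ^ n * Ψ (t • (x - y))) * φ y : ℝ) : ℂ)) ξ
            - 𝓕 (fun x => (φ x : ℂ)) ξ‖ ^ 2))
      atTop (nhds 0) := by
  have hΨi : Integrable Ψ := hΨ_smooth.continuous.integrable_of_hasCompactSupport
    (HasCompactSupport.of_support_subset_isCompact (isCompact_closedBall 0 1) hΨ_supp)
  have hφi : Integrable φ := hφ.integrable_of_hasCompactSupport hφc
  set f : ℝ → EuclideanSpace ℝ (Fin n) → ℝ := fun t x => t ^ n * Ψ (t • x) with hf
  set N : ℝ → EuclideanSpace ℝ (Fin n) → ℝ :=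
    fun t ξ => ‖𝓕 (fun x => (f t x : ℂ)) ξ - 1‖ with hNdef
  have hfi : ∀ t > 0, Integrable (f t) := fun t ht => (hΨi.comp_smul ht.ne').const_mul _
  have hf0 : ∀ t > 0, ∀ x, 0 ≤ f t x := fun t ht x => mul_nonneg (by positivity) (hΨ_nonneg _)
  have hf1 : ∀ t > 0, ∫ x, f t x = 1 := by
    intro t ht
    simp only [hf]
    rw [integral_const_mul, Measure.integral_comp_smul, hΨ_int, finrank_euclideanSpace_fin,
      abs_of_pos (by positivity), smul_eq_mul, mul_one, mul_inv_cancel₀ (by positivity)]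
  have hfs : ∀ t > 0, Function.support (f t) ⊆ Metric.closedBall 0 t⁻¹ := by
    intro t ht x hx
    have h := hΨ_supp (Function.mem_support.2 (right_ne_zero_of_mul hx))
    rw [mem_closedBall_zero_iff, norm_smul, Real.norm_of_nonneg ht.le] at h
    rw [mem_closedBall_zero_iff]
    rwa [← one_div, le_div_iff₀' ht]
  have hN : ∀ t > 0, ∀ ξ, N t ξ ≤ 2 * Real.pi ^ 2 * (‖ξ‖ / t) ^ 2 := by
    intro t ht ξ
    refine (norm_fourier_sub_one_le_sq (hfi t ht) (hf0 t ht) (fun x => ?_) (hfs t ht)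
      (hf1 t ht) ξ).trans_eq (by field_simp)
    simp only [hf]
    rw [hΨ_radial (t • -x) (t • x) (by simp)]
  have hN2 : ∀ t > 0, ∀ ξ, N t ξ ≤ 2 := fun t ht ξ =>
    norm_fourier_sub_one_le_two (hf0 t ht) (hf1 t ht) ξ
  set P : EuclideanSpace ℝ (Fin n) → ℝ := fun ξ => ‖𝓕 (fun x => (φ x : ℂ)) ξ‖ ^ 2 with hP
  have hPc : Continuous P := (continuous_fourier_of_integrable hφi.ofReal).norm.pow 2
  have hNc : ∀ t > 0, Continuous (N t) := fun t ht =>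
    ((continuous_fourier_of_integrable (hfi t ht).ofReal).sub continuous_const).norm
  have hfactor : ∀ t > 0, ∀ ξ, ‖𝓕 (fun x => ((∫ y, f t (x - y) * φ y : ℝ) : ℂ)) ξ
      - 𝓕 (fun x => (φ x : ℂ)) ξ‖ ^ 2 = N t ξ ^ 2 * P ξ := by
    intro t ht ξ
    rw [fourier_integral_sub_mul (hfi t ht) hφi, ← sub_one_mul, norm_mul, mul_pow]
  have hlim : Tendsto (fun t : ℝ => ∫⁻ ξ, ENNReal.ofReal
      (t ^ (3 - 2 * σ) * ‖ξ‖ ^ (2 * σ) * N t ξ ^ 2 * P ξ)) atTop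
      (nhds (∫⁻ _ : EuclideanSpace ℝ (Fin n), 0)) := by
    refine tendsto_lintegral_filter_of_dominated_convergence
      (fun ξ => ENNReal.ofReal ((2 * Real.pi ^ 2) ^ 2) * ENNReal.ofReal (‖ξ‖ ^ 3 * P ξ)) ?_ ?_ ?_ ?_
    · filter_upwards [eventually_gt_atTop 0] with t ht
      have := (hNc t ht).measurable
      have := hPc.measurable
      fun_prop
    · filter_upwards [eventually_gt_atTop 0] with t ht
      refine Eventually.of_forall fun ξ => ?_
      rw [← ENNReal.ofReal_mul (by positivity), ← mul_assoc]
      exact ENNReal.ofReal_le_ofReal (mul_le_mul_of_nonneg_right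
        (rpow_mul_rpow_mul_sq_le hσ0 hσ ht (norm_nonneg ξ) (norm_nonneg _) (hN2 t ht ξ)
          (hN t ht ξ)) (by positivity))
    · rw [lintegral_const_mul' _ _ ENNReal.ofReal_ne_top]
      exact ENNReal.mul_ne_top ENNReal.ofReal_ne_top hφH
    · refine Eventually.of_forall fun ξ => ?_
      have h := (tendsto_rpow_mul_rpow_mul_sq (N := fun t => N t ξ) hσ0 (norm_nonneg ξ)
        (fun t => norm_nonneg _) (fun t ht => hN t ht ξ)).mul_const (P ξ)
      rw [zero_mul] at h
      simpa using ENNReal.tendsto_ofReal h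
  rw [lintegral_zero] at hlim
  refine hlim.congr' ?_
  filter_upwards [eventually_gt_atTop 0] with t ht
  refine lintegral_congr fun ξ => ?_
  rw [hfactor t ht ξ, mul_assoc _ (N t ξ ^ 2)]
end

section
/- Let n ≥ 1 and let φ : ℝⁿ → ℝ be continuous with compact support and satisfy ∫_{ℝⁿ} ‖ξ‖³ |𝓕φ(ξ)|² dξ < ∞. Then lim_{t→∞} t^{−1} ∫_{ℝⁿ} ‖ξ‖⁴ |𝓕φ_t(ξ)|² dξ = 0; in particular, for every multi-index α with |α| = 2, ‖D^α φ_t‖_{L²(ℝⁿ)} = o(t^{1/2}) as t → ∞. -/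
open MeasureTheory Filter
open scoped FourierTransform

theorem fourier_dilation {n : ℕ} (f : EuclideanSpace ℝ (Fin n) → ℂ) {t : ℝ} (ht : 0 < t)
    (ξ : EuclideanSpace ℝ (Fin n)) :
    𝓕 (fun x => (t : ℂ) ^ n * f (t • x)) ξ = 𝓕 f (t⁻¹ • ξ) := by
  have h := Measure.integral_comp_smul volume
    (fun x : EuclideanSpace ℝ (Fin n) => Real.fourierChar (-inner ℝ x (t⁻¹ • ξ)) • f x) t
  have htn : (t : ℂ) ^ n ≠ 0 := pow_ne_zero _ (by exact_mod_cast ht.ne')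
  rw [finrank_euclideanSpace_fin, abs_of_pos (by positivity)] at h
  simp only [inner_smul_left, inner_smul_right, RCLike.conj_to_real] at h
  rw [Real.fourier_eq, Real.fourier_eq]
  simp only [inner_smul_right]
  calc _ = (t : ℂ) ^ n * ∫ x, Real.fourierChar (-(t⁻¹ * (t * inner ℝ x ξ))) • f (t • x) := by
        rw [← integral_const_mul]
        congr with x
        rw [inv_mul_cancel_left₀ ht.ne']
        simp only [Circle.smul_def, smul_eq_mul]
        ring
    _ = _ := by
        rw [h, Complex.real_smul]
        push_cast
        rw [mul_inv_cancel_left₀ htn]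

theorem fourier_mollification {n : ℕ} {Ψ φ : EuclideanSpace ℝ (Fin n) → ℝ}
    (hΨ : Integrable Ψ) (hφ : Integrable φ) {t : ℝ} (ht : 0 < t)
    (ξ : EuclideanSpace ℝ (Fin n)) :
    𝓕 (fun x => ((∫ y, (t ^ n * Ψ (t • (x - y))) * φ y : ℝ) : ℂ)) ξ =
      𝓕 (fun x => (Ψ x : ℂ)) (t⁻¹ • ξ) * 𝓕 (fun x => (φ x : ℂ)) ξ := by
  have hΨt : Integrable (fun x => (t : ℂ) ^ n * (Ψ (t • x) : ℂ)) :=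
    ((hΨ.comp_smul ht.ne').ofReal (𝕜 := ℂ)).const_mul _
  have hφℂ : Integrable (fun x => (φ x : ℂ)) := hφ.ofReal
  rw [← fourier_dilation _ ht, ← Real.fourier_mul_convolution_eq hΨt hφℂ]
  refine congrFun (congrArg 𝓕 (funext fun x => ?_)) ξ
  rw [convolution_mul_swap, ← integral_complex_ofReal]
  push_cast
  rfl

theorem SchwartzMap.exists_norm_mul_sq_le {V F : Type*} [NormedAddCommGroup V] [NormedSpace ℝ V]
    [NormedAddCommGroup F] [NormedSpace ℝ F] (f : SchwartzMap V F) :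
    ∃ C, ∀ x, ‖x‖ * ‖f x‖ ^ 2 ≤ C := by
  obtain ⟨A, -, hA⟩ := f.decay 0 0
  obtain ⟨B, hB0, hB⟩ := f.decay 1 0
  simp only [pow_zero, one_mul, pow_one, norm_iteratedFDeriv_zero] at hA hB
  refine ⟨B * A, fun x => ?_⟩
  calc ‖x‖ * ‖f x‖ ^ 2 = (‖x‖ * ‖f x‖) * ‖f x‖ := by ring
    _ ≤ B * A := mul_le_mul (hB x) (hA x) (norm_nonneg _) hB0.le

/-- If `φ` is continuous with compact support and lies in `H^{3/2,2}(ℝⁿ)`,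
then `t⁻¹ ∫ ‖ξ‖⁴ |𝓕φ_t(ξ)|² dξ → 0` as `t → ∞`; in particular
`‖D^α φ_t‖_{L²} = o(t^{1/2})` for every multi-index `α` with `|α| = 2`. -/
theorem stmt_3 (n : ℕ) (hn : 1 ≤ n)
    (Ψ : EuclideanSpace ℝ (Fin n) → ℝ)
    (hΨ_smooth : ContDiff ℝ (⊤ : ℕ∞) Ψ)
    (hΨ_nonneg : ∀ x, 0 ≤ Ψ x)
    (hΨ_radial : ∀ x y : EuclideanSpace ℝ (Fin n), ‖x‖ = ‖y‖ → Ψ x = Ψ y)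
    (hΨ_supp : Function.support Ψ ⊆ Metric.closedBall 0 1)
    (hΨ_int : ∫ x, Ψ x = 1)
    (φ : EuclideanSpace ℝ (Fin n) → ℝ)
    (hφ : Continuous φ) (hφc : HasCompactSupport φ)
    (hφH : ∫⁻ ξ, ENNReal.ofReal (‖ξ‖ ^ 3 * ‖𝓕 (fun x => (φ x : ℂ)) ξ‖ ^ 2) ≠ ⊤) :
    Tendsto (fun t : ℝ => ∫⁻ ξ, ENNReal.ofReal
        (t⁻¹ * ‖ξ‖ ^ 4 *
          ‖𝓕 (fun x => ((∫ y, (t ^ n * Ψ (t • (x - y))) * φ y : ℝ) : ℂ)) ξ‖ ^ 2))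
      atTop (nhds 0) := by
  have hΨc : HasCompactSupport Ψ :=
    HasCompactSupport.intro (isCompact_closedBall 0 1) fun x hx => by
      by_contra h
      exact hx (hΨ_supp h)
  have hΨi : Integrable Ψ := hΨ_smooth.continuous.integrable_of_hasCompactSupport hΨc
  have hφi : Integrable φ := hφ.integrable_of_hasCompactSupport hφc
  let S : SchwartzMap (EuclideanSpace ℝ (Fin n)) ℂ :=
    (hΨc.comp_left (g := Complex.ofRealCLM) (map_zero _)).toSchwartzMap
      (Complex.ofRealCLM.contDiff.comp hΨ_smooth)
  have hS : ∀ ξ, 𝓕 (fun x => (Ψ x : ℂ)) ξ = 𝓕 S ξ := fun ξ => rfl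
  have hφF : Continuous (𝓕 (fun x => (φ x : ℂ))) :=
    VectorFourier.fourierIntegral_continuous Real.continuous_fourierChar
      continuous_inner hφi.ofReal
  obtain ⟨C, hC⟩ := (𝓕 S).exists_norm_mul_sq_le
  obtain ⟨A, -, hA⟩ := (𝓕 S).decay 0 0
  simp only [pow_zero, one_mul, norm_iteratedFDeriv_zero] at hA
  have key : ∀ t : ℝ, 0 < t → ∀ ξ, t⁻¹ * ‖ξ‖ ^ 4 *
      ‖𝓕 (fun x => ((∫ y, (t ^ n * Ψ (t • (x - y))) * φ y : ℝ) : ℂ)) ξ‖ ^ 2 =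
      t⁻¹ * ‖ξ‖ ^ 4 * (‖𝓕 S (t⁻¹ • ξ)‖ * ‖𝓕 (fun x => (φ x : ℂ)) ξ‖) ^ 2 := fun t ht ξ => by
    rw [fourier_mollification hΨi hφi ht, hS, norm_mul]
  rw [← lintegral_zero (μ := (volume : Measure (EuclideanSpace ℝ (Fin n))))]
  refine tendsto_lintegral_filter_of_dominated_convergence
    (fun ξ => ENNReal.ofReal C *
      ENNReal.ofReal (‖ξ‖ ^ 3 * ‖𝓕 (fun x => (φ x : ℂ)) ξ‖ ^ 2)) ?_ ?_ ?_ ?_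
  · filter_upwards [eventually_gt_atTop 0] with t ht
    simp only [key t ht]
    have := (𝓕 S).continuous
    exact (ENNReal.continuous_ofReal.comp (by fun_prop)).measurable
  · filter_upwards [eventually_gt_atTop 0] with t ht
    refine Eventually.of_forall fun ξ => ?_
    rw [key t ht, ← ENNReal.ofReal_mul' (by positivity)]
    refine ENNReal.ofReal_le_ofReal ?_
    have h := hC (t⁻¹ • ξ)
    rw [norm_smul, Real.norm_of_nonneg (inv_pos.2 ht).le] at h
    calc _ = (t⁻¹ * ‖ξ‖ * ‖𝓕 S (t⁻¹ • ξ)‖ ^ 2) *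
          (‖ξ‖ ^ 3 * ‖𝓕 (fun x => (φ x : ℂ)) ξ‖ ^ 2) := by ring
      _ ≤ _ := by gcongr
  · rw [lintegral_const_mul' _ _ ENNReal.ofReal_ne_top]
    exact ENNReal.mul_ne_top ENNReal.ofReal_ne_top hφH
  · refine Eventually.of_forall fun ξ => ?_
    rw [← ENNReal.ofReal_zero]
    refine ENNReal.tendsto_ofReal ?_
    have hlim : Tendsto (fun t : ℝ => t⁻¹ *
        (‖ξ‖ ^ 4 * (A * ‖𝓕 (fun x => (φ x : ℂ)) ξ‖) ^ 2)) atTop (nhds 0) := by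
      simpa using tendsto_inv_atTop_zero.mul_const
        (‖ξ‖ ^ 4 * (A * ‖𝓕 (fun x => (φ x : ℂ)) ξ‖) ^ 2)
    refine squeeze_zero' ?_ ?_ hlim
    · filter_upwards [eventually_gt_atTop 0] with t ht
      positivity
    · filter_upwards [eventually_gt_atTop 0] with t ht
      rw [key t ht, mul_assoc]
      gcongr
      exact hA _
end

section
/- Let v and w be measurable weights on ℝⁿ with v(η) > 0 and w(ξ) ≥ 0 for all ξ, η, let Φ : ℝⁿ → ℂ be integrable, and set J(ξ,η) = |Φ(ξ−η)| w(ξ)/v(η). Then for every measurable f : ℝⁿ → ℂ, (∫_{ℝⁿ} |(Φ * f)(ξ)|² w(ξ) dξ)^{1/2} ≤ ‖Φ‖_{L¹}^{1/2} · min{ sup_ξ (∫ J(ξ,η) dη)^{1/2}, sup_η (∫ J(ξ,η) dξ)^{1/2} } · (∫_{ℝⁿ} |f(η)|² v(η) dη)^{1/2}, where Φ * f denotes convolution and both sides are interpreted in [0,∞]. -/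
open MeasureTheory ENNReal

/-- Cauchy–Schwarz for lower Lebesgue integrals. -/
lemma lintegral_sq_le_mul_of_sq_le {α : Type*} [MeasurableSpace α] {μ : Measure α}
    {h a b : α → ℝ≥0∞} (ha : AEMeasurable a μ) (hb : AEMeasurable b μ)
    (hab : ∀ x, h x ^ 2 ≤ a x * b x) :
    (∫⁻ x, h x ∂μ) ^ 2 ≤ (∫⁻ x, a x ∂μ) * ∫⁻ x, b x ∂μ := by
  have hsq (x y z : ℝ≥0∞) : x ^ 2 ≤ y * z ↔ x ≤ y ^ (1 / 2 : ℝ) * z ^ (1 / 2 : ℝ) := by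
    rw [← ENNReal.mul_rpow_of_nonneg _ _ (by norm_num), one_div,
      ENNReal.le_rpow_inv_iff (by norm_num), ENNReal.rpow_two]
  rw [hsq]
  exact (lintegral_mono fun x => (hsq _ _ _).1 (hab x)).trans
    (ENNReal.lintegral_mul_norm_pow_le ha hb (by norm_num) (by norm_num) (by norm_num))

section Schur

variable {E : Type*} [AddCommGroup E] [MeasurableSpace E] [MeasurableAdd₂ E] [MeasurableNeg E]
  {μ : Measure E} [SFinite μ] [μ.IsAddLeftInvariant]
  {G g v w : E → ℝ≥0∞}

lemma lintegral_weighted_conv_sq_le_iSup_left (hG : Measurable G) (hg : Measurable g)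
    (hv : Measurable v) (hv0 : ∀ η, v η ≠ 0) (hvt : ∀ η, v η ≠ ∞) :
    ∫⁻ ξ, w ξ * (∫⁻ η, G (ξ - η) * g η ∂μ) ^ 2 ∂μ ≤
      (∫⁻ x, G x ∂μ) * (⨆ ξ, ∫⁻ η, G (ξ - η) * w ξ / v η ∂μ) * ∫⁻ η, v η * g η ^ 2 ∂μ := by
  set B := ⨆ ξ, ∫⁻ η, G (ξ - η) * w ξ / v η ∂μ
  have pointwise (ξ : E) : w ξ * (∫⁻ η, G (ξ - η) * g η ∂μ) ^ 2 ≤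
      B * ∫⁻ η, G (ξ - η) * (v η * g η ^ 2) ∂μ := by
    have cs : (∫⁻ η, G (ξ - η) * g η ∂μ) ^ 2 ≤
        (∫⁻ η, G (ξ - η) / v η ∂μ) * ∫⁻ η, G (ξ - η) * (v η * g η ^ 2) ∂μ := by
      refine lintegral_sq_le_mul_of_sq_le (by fun_prop) (by fun_prop) fun η => le_of_eq ?_
      calc (G (ξ - η) * g η) ^ 2 = G (ξ - η) * G (ξ - η) * g η ^ 2 * ((v η)⁻¹ * v η) := by
            rw [ENNReal.inv_mul_cancel (hv0 η) (hvt η)]; ring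
        _ = _ := by rw [div_eq_mul_inv]; ring
    calc _ ≤ w ξ * ((∫⁻ η, G (ξ - η) / v η ∂μ) * ∫⁻ η, G (ξ - η) * (v η * g η ^ 2) ∂μ) := by
          gcongr
      _ = (∫⁻ η, G (ξ - η) * w ξ / v η ∂μ) * ∫⁻ η, G (ξ - η) * (v η * g η ^ 2) ∂μ := by
          rw [← mul_assoc, ← lintegral_const_mul (w ξ) (by fun_prop)]
          congr 2 with η
          simp only [div_eq_mul_inv]; ring
      _ ≤ _ := by gcongr; exact le_iSup (fun ξ => ∫⁻ η, G (ξ - η) * w ξ / v η ∂μ) ξ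
  calc _ ≤ ∫⁻ ξ, B * ∫⁻ η, G (ξ - η) * (v η * g η ^ 2) ∂μ ∂μ := lintegral_mono pointwise
    _ = B * ∫⁻ η, ∫⁻ ξ, G (ξ - η) * (v η * g η ^ 2) ∂μ ∂μ := by
        rw [lintegral_const_mul _ (Measurable.lintegral_prod_right (by fun_prop)),
          lintegral_lintegral_swap (by fun_prop)]
    _ = B * ∫⁻ η, (∫⁻ x, G x ∂μ) * (v η * g η ^ 2) ∂μ := by
        congr 2 with η
        rw [lintegral_mul_const _ (by fun_prop), lintegral_sub_right_eq_self]
    _ = _ := by rw [lintegral_const_mul _ (by fun_prop)]; ring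

lemma lintegral_weighted_conv_sq_le_iSup_right [μ.IsNegInvariant]
    (hG : Measurable G) (hg : Measurable g)
    (hv : Measurable v) (hw : Measurable w) (hv0 : ∀ η, v η ≠ 0) (hvt : ∀ η, v η ≠ ∞) :
    ∫⁻ ξ, w ξ * (∫⁻ η, G (ξ - η) * g η ∂μ) ^ 2 ∂μ ≤
      (∫⁻ x, G x ∂μ) * (⨆ η, ∫⁻ ξ, G (ξ - η) * w ξ / v η ∂μ) * ∫⁻ η, v η * g η ^ 2 ∂μ := by
  set B := ⨆ η, ∫⁻ ξ, G (ξ - η) * w ξ / v η ∂μ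
  set A := ∫⁻ x, G x ∂μ with hA
  have pointwise (ξ : E) : w ξ * (∫⁻ η, G (ξ - η) * g η ∂μ) ^ 2 ≤
      A * ∫⁻ η, (G (ξ - η) * w ξ / v η) * (v η * g η ^ 2) ∂μ := by
    have cs : (∫⁻ η, G (ξ - η) * g η ∂μ) ^ 2 ≤ A * ∫⁻ η, G (ξ - η) * g η ^ 2 ∂μ := by
      rw [hA, ← lintegral_sub_left_eq_self G ξ]
      exact lintegral_sq_le_mul_of_sq_le (by fun_prop) (by fun_prop) fun η => le_of_eq (by ring)
    calc _ ≤ w ξ * (A * ∫⁻ η, G (ξ - η) * g η ^ 2 ∂μ) := by gcongr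
      _ = A * ∫⁻ η, w ξ * (G (ξ - η) * g η ^ 2) ∂μ := by
          rw [lintegral_const_mul _ (by fun_prop)]; ring
      _ = _ := by
          congr 2 with η
          calc _ = w ξ * (G (ξ - η) * g η ^ 2) * ((v η)⁻¹ * v η) := by
                rw [ENNReal.inv_mul_cancel (hv0 η) (hvt η), mul_one]
            _ = _ := by rw [div_eq_mul_inv]; ring
  calc _ ≤ ∫⁻ ξ, A * ∫⁻ η, (G (ξ - η) * w ξ / v η) * (v η * g η ^ 2) ∂μ ∂μ :=
        lintegral_mono pointwise
    _ = A * ∫⁻ η, ∫⁻ ξ, (G (ξ - η) * w ξ / v η) * (v η * g η ^ 2) ∂μ ∂μ := by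
        rw [lintegral_const_mul _ (Measurable.lintegral_prod_right (by fun_prop)),
          lintegral_lintegral_swap (by fun_prop)]
    _ ≤ A * ∫⁻ η, B * (v η * g η ^ 2) ∂μ := by
        gcongr with η
        rw [lintegral_mul_const _ (by fun_prop)]
        gcongr
        exact le_iSup (fun η => ∫⁻ ξ, G (ξ - η) * w ξ / v η ∂μ) η
    _ = _ := by rw [lintegral_const_mul _ (by fun_prop)]; ring

end Schur

/-- Weighted Schur-type convolution bound (Proposition 3.1):
`‖Φ * f‖_{L²_w} ≤ ‖Φ‖_{L¹}^{1/2} · min(sup_ξ (∫ J dη)^{1/2}, sup_η (∫ J dξ)^{1/2}) · ‖f‖_{L²_v}`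
where `J(ξ,η) = |Φ(ξ-η)| w(ξ)/v(η)`, all quantities interpreted in `[0,∞]`. -/
theorem stmt_5 (n : ℕ)
    (v w : EuclideanSpace ℝ (Fin n) → ℝ)
    (hv : Measurable v) (hw : Measurable w)
    (hvpos : ∀ η, 0 < v η) (hwnonneg : ∀ ξ, 0 ≤ w ξ)
    (Φ : EuclideanSpace ℝ (Fin n) → ℂ) (hΦ : Integrable Φ)
    (f : EuclideanSpace ℝ (Fin n) → ℂ) (hf : Measurable f) :
    (∫⁻ ξ, ENNReal.ofReal (w ξ) * ENNReal.ofReal (‖∫ η, Φ (ξ - η) * f η‖ ^ 2)) ^ (1/2 : ℝ) ≤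
      (∫⁻ x, ENNReal.ofReal ‖Φ x‖) ^ (1/2 : ℝ) *
        min
          (⨆ ξ, (∫⁻ η, ENNReal.ofReal ‖Φ (ξ - η)‖ * ENNReal.ofReal (w ξ)
              / ENNReal.ofReal (v η)) ^ (1/2 : ℝ))
          (⨆ η, (∫⁻ ξ, ENNReal.ofReal ‖Φ (ξ - η)‖ * ENNReal.ofReal (w ξ)
              / ENNReal.ofReal (v η)) ^ (1/2 : ℝ)) *
        (∫⁻ η, ENNReal.ofReal (v η) * ENNReal.ofReal (‖f η‖ ^ 2)) ^ (1/2 : ℝ) := by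
  obtain ⟨G, hG, hΦG⟩ := hΦ.aestronglyMeasurable.enorm
  have hl (ξ) : ∀ᵐ η, ‖Φ (ξ - η)‖ₑ = G (ξ - η) :=
    (quasiMeasurePreserving_sub_left volume ξ).ae hΦG
  have hr (η) : ∀ᵐ ξ, ‖Φ (ξ - η)‖ₑ = G (ξ - η) :=
    (measurePreserving_sub_right volume η).quasiMeasurePreserving.ae hΦG
  have hv0 (η) : ENNReal.ofReal (v η) ≠ 0 := by simpa using hvpos η
  have hvt (η) : ENNReal.ofReal (v η) ≠ ∞ := ENNReal.ofReal_ne_top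
  have conv_le : ∫⁻ ξ, ENNReal.ofReal (w ξ) * ‖∫ η, Φ (ξ - η) * f η‖ₑ ^ 2 ≤
      ∫⁻ ξ, ENNReal.ofReal (w ξ) * (∫⁻ η, G (ξ - η) * ‖f η‖ₑ) ^ 2 := by
    gcongr with ξ
    refine (enorm_integral_le_lintegral_enorm _).trans (lintegral_mono_ae ?_)
    filter_upwards [hl ξ] with η hη
    rw [enorm_mul, hη]
  have hJl (ξ) : ∫⁻ η, ‖Φ (ξ - η)‖ₑ * ENNReal.ofReal (w ξ) / ENNReal.ofReal (v η) =
      ∫⁻ η, G (ξ - η) * ENNReal.ofReal (w ξ) / ENNReal.ofReal (v η) :=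
    lintegral_congr_ae <| by filter_upwards [hl ξ] with η hη; rw [hη]
  have hJr (η) : ∫⁻ ξ, ‖Φ (ξ - η)‖ₑ * ENNReal.ofReal (w ξ) / ENNReal.ofReal (v η) =
      ∫⁻ ξ, G (ξ - η) * ENNReal.ofReal (w ξ) / ENNReal.ofReal (v η) :=
    lintegral_congr_ae <| by filter_upwards [hr η] with ξ hξ; rw [hξ]
  have iSup_rpow (F : EuclideanSpace ℝ (Fin n) → ℝ≥0∞) :
      ⨆ x, F x ^ (1 / 2 : ℝ) = (⨆ x, F x) ^ (1 / 2 : ℝ) :=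
    ((ENNReal.orderIsoRpow (1 / 2) (by norm_num)).map_iSup F).symm
  simp only [ENNReal.ofReal_pow (norm_nonneg _), ofReal_norm, hJl, hJr, iSup_rpow,
    lintegral_congr_ae hΦG]
  rw [← (ENNReal.monotone_rpow_of_nonneg (by norm_num : (0 : ℝ) ≤ 1 / 2)).map_min,
    ← ENNReal.mul_rpow_of_nonneg _ _ (by norm_num), ← ENNReal.mul_rpow_of_nonneg _ _ (by norm_num)]
  gcongr
  refine conv_le.trans ?_
  rcases min_choice (⨆ ξ, ∫⁻ η, G (ξ - η) * ENNReal.ofReal (w ξ) / ENNReal.ofReal (v η))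
    (⨆ η, ∫⁻ ξ, G (ξ - η) * ENNReal.ofReal (w ξ) / ENNReal.ofReal (v η)) with h | h
  · rw [h]
    exact lintegral_weighted_conv_sq_le_iSup_left hG hf.enorm hv.ennreal_ofReal
      hv0 hvt
  · rw [h]
    exact lintegral_weighted_conv_sq_le_iSup_right hG hf.enorm hv.ennreal_ofReal hw.ennreal_ofReal
      hv0 hvt
end

section
/- Let n ≥ 2. For every Schwartz function g : ℝⁿ → ℂ there is a constant C > 0 such that for all s ≥ 1, all orthonormal unit vectors e₁, e₂ ∈ ℝⁿ, and all ξ ∈ ℝⁿ: ∫_{ℝⁿ} |g(ξ−η)| · ‖ξ‖ / (s + |p_ζ(η)|) dη ≤ C. -/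
open MeasureTheory
open scoped RealInnerProductSpace

/-- The modulus `|p_ζ(ξ)|` of the symbol `p_ζ(ξ) = -‖ξ‖² + 2iζ·ξ` of the conjugated
Laplacian `Δ + 2ζ·∇`, where `ζ = s(e₁ - i e₂)`. -/
noncomputable def pAbs {n : ℕ} (s : ℝ) (e₁ e₂ ξ : EuclideanSpace ℝ (Fin n)) : ℝ :=
  Real.sqrt ((‖ξ‖ ^ 2 - 2 * s * ⟪e₂, ξ⟫) ^ 2 + 4 * s ^ 2 * ⟪e₁, ξ⟫ ^ 2)

lemma pAbs_nonneg {n : ℕ} (s : ℝ) (e₁ e₂ ξ : EuclideanSpace ℝ (Fin n)) :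
    0 ≤ pAbs s e₁ e₂ ξ :=
  Real.sqrt_nonneg _

lemma norm_sq_sub_le_pAbs {n : ℕ} {s : ℝ} (hs : 0 ≤ s) (e₁ : EuclideanSpace ℝ (Fin n))
    {e₂ : EuclideanSpace ℝ (Fin n)} (h₂ : ‖e₂‖ = 1) (ξ : EuclideanSpace ℝ (Fin n)) :
    ‖ξ‖ ^ 2 - 2 * s * ‖ξ‖ ≤ pAbs s e₁ e₂ ξ := by
  have hinner : ⟪e₂, ξ⟫ ≤ ‖ξ‖ := by simpa [h₂] using real_inner_le_norm e₂ ξ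
  calc ‖ξ‖ ^ 2 - 2 * s * ‖ξ‖ ≤ ‖ξ‖ ^ 2 - 2 * s * ⟪e₂, ξ⟫ := by gcongr
    _ ≤ pAbs s e₁ e₂ ξ := Real.le_sqrt_of_sq_le (le_add_of_nonneg_right (by positivity))

lemma norm_le_four_mul_add_pAbs {n : ℕ} {s : ℝ} (hs : 1 ≤ s)
    (e₁ : EuclideanSpace ℝ (Fin n)) {e₂ : EuclideanSpace ℝ (Fin n)} (h₂ : ‖e₂‖ = 1)
    (ξ : EuclideanSpace ℝ (Fin n)) :
    ‖ξ‖ ≤ 4 * (s + pAbs s e₁ e₂ ξ) := by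
  have hp := pAbs_nonneg s e₁ e₂ ξ
  rcases le_total ‖ξ‖ (4 * s) with h | h
  · linarith
  · have := norm_sq_sub_le_pAbs (zero_le_one.trans hs) e₁ h₂ ξ
    nlinarith [mul_le_mul_of_nonneg_right h (norm_nonneg ξ)]

/-- For every Schwartz function `g` there is `C > 0` such that for all `s ≥ 1`,
orthonormal `e₁, e₂` and all `ξ`: `∫ |g(ξ-η)| ‖ξ‖/(s + |p_ζ(η)|) dη ≤ C`. -/
theorem stmt_6 (n : ℕ) (hn : 2 ≤ n)
    (g : SchwartzMap (EuclideanSpace ℝ (Fin n)) ℂ) :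
    ∃ C > 0, ∀ s ≥ (1 : ℝ), ∀ e₁ e₂ : EuclideanSpace ℝ (Fin n),
      ‖e₁‖ = 1 → ‖e₂‖ = 1 → ⟪e₁, e₂⟫ = 0 →
      ∀ ξ : EuclideanSpace ℝ (Fin n),
        ∫ η, ‖g (ξ - η)‖ * ‖ξ‖ / (s + pAbs s e₁ e₂ η) ≤ C := by
  set G : EuclideanSpace ℝ (Fin n) → ℝ := fun x => ‖g x‖ * (4 + ‖x‖) with hG
  have hGint : Integrable G := by
    have h := (g.integrable.norm.const_mul 4).add (g.integrable_pow_mul volume 1)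
    refine h.congr (.of_forall fun x => ?_)
    simp only [hG, Pi.add_apply]
    ring
  have hG0 : 0 ≤ ∫ x, G x := integral_nonneg fun x => by positivity
  refine ⟨(∫ x, G x) + 1, by linarith, fun s hs e₁ e₂ _ h₂ _ ξ => ?_⟩
  have hle : ∫ η, ‖g (ξ - η)‖ * ‖ξ‖ / (s + pAbs s e₁ e₂ η) ≤ ∫ η, G (ξ - η) := by
    refine integral_mono_of_nonneg (.of_forall fun η => ?_) (hGint.comp_sub_left ξ)
      (.of_forall fun η => ?_)
    · have := pAbs_nonneg s e₁ e₂ η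
      simp only [Pi.zero_apply]
      positivity
    · have hp := pAbs_nonneg s e₁ e₂ η
      have hη := norm_le_four_mul_add_pAbs hs e₁ h₂ η
      have htri : ‖ξ‖ ≤ ‖ξ - η‖ + ‖η‖ := norm_le_norm_sub_add ξ η
      simp only [hG]
      rw [mul_div_assoc]
      gcongr
      rw [div_le_iff₀ (by linarith)]
      nlinarith [norm_nonneg (ξ - η)]
  rw [integral_sub_left_eq_self G volume ξ] at hle
  linarith
end

section
/- Let n ≥ 2. There is a constant C > 0, depending only on n, such that for all s ≥ 1, all orthonormal unit vectors e₁, e₂ ∈ ℝⁿ, and all ξ ∈ ℝⁿ: ‖ξ‖ ≤ C (s + |p_ζ(ξ)|). -/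
open MeasureTheory
open scoped RealInnerProductSpace

/-- There is `C > 0` depending only on `n` such that for all `s ≥ 1`,
orthonormal `e₁, e₂` and all `ξ`: `‖ξ‖ ≤ C (s + |p_ζ(ξ)|)`. -/
theorem stmt_7 (n : ℕ) (hn : 2 ≤ n) :
    ∃ C > 0, ∀ s ≥ (1 : ℝ), ∀ e₁ e₂ : EuclideanSpace ℝ (Fin n),
      ‖e₁‖ = 1 → ‖e₂‖ = 1 → ⟪e₁, e₂⟫ = 0 →
      ∀ ξ : EuclideanSpace ℝ (Fin n),
        ‖ξ‖ ≤ C * (s + pAbs s e₁ e₂ ξ) := by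
  refine ⟨3, by norm_num, fun s hs e₁ e₂ _ he₂ _ ξ => ?_⟩
  have hξ : 0 ≤ ‖ξ‖ := norm_nonneg ξ
  have hp : ‖ξ‖ ^ 2 - 2 * s * ⟪e₂, ξ⟫ ≤ pAbs s e₁ e₂ ξ :=
    Real.le_sqrt_of_sq_le (le_add_of_nonneg_right (by positivity))
  have hp₀ : 0 ≤ pAbs s e₁ e₂ ξ := Real.sqrt_nonneg _
  have hinner : ⟪e₂, ξ⟫ ≤ ‖ξ‖ := by simpa [he₂] using real_inner_le_norm e₂ ξ
  rcases le_total ‖ξ‖ (3 * s) with h | h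
  · linarith
  · have h₁ : s * ⟪e₂, ξ⟫ ≤ s * ‖ξ‖ := mul_le_mul_of_nonneg_left hinner (by linarith)
    have h₂ : ‖ξ‖ ≤ ‖ξ‖ * (‖ξ‖ - 2 * s) := le_mul_of_one_le_right hξ (by linarith)
    nlinarith
end

section
/- Let n ≥ 2. There is a constant C > 0, depending only on n, such that for all s ≥ 1, all orthonormal unit vectors e₁, e₂ ∈ ℝⁿ, and all ξ ∈ ℝⁿ: ‖ξ‖² ≤ C s (s + |p_ζ(ξ)|). -/
open MeasureTheory
open scoped RealInnerProductSpace

/-- There is `C > 0` depending only on `n` such that for all `s ≥ 1`,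
orthonormal `e₁, e₂` and all `ξ`: `‖ξ‖² ≤ C s (s + |p_ζ(ξ)|)`. -/
theorem stmt_8 (n : ℕ) (hn : 2 ≤ n) :
    ∃ C > 0, ∀ s ≥ (1 : ℝ), ∀ e₁ e₂ : EuclideanSpace ℝ (Fin n),
      ‖e₁‖ = 1 → ‖e₂‖ = 1 → ⟪e₁, e₂⟫ = 0 →
      ∀ ξ : EuclideanSpace ℝ (Fin n),
        ‖ξ‖ ^ 2 ≤ C * s * (s + pAbs s e₁ e₂ ξ) := by
  refine ⟨4, by norm_num, fun s hs e₁ e₂ _ h₂ _ ξ => ?_⟩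
  have hp : ‖ξ‖ ^ 2 - 2 * s * ⟪e₂, ξ⟫ ≤ pAbs s e₁ e₂ ξ :=
    Real.le_sqrt_of_sq_le (le_add_of_nonneg_right (by positivity))
  have hp₀ : 0 ≤ pAbs s e₁ e₂ ξ := Real.sqrt_nonneg _
  have hi : ⟪e₂, ξ⟫ ≤ ‖ξ‖ := by simpa [h₂] using real_inner_le_norm e₂ ξ
  have hsi : s * ⟪e₂, ξ⟫ ≤ s * ‖ξ‖ := by gcongr
  have hsp : pAbs s e₁ e₂ ξ ≤ s * pAbs s e₁ e₂ ξ := le_mul_of_one_le_left hp₀ hs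
  nlinarith [sq_nonneg (‖ξ‖ - 2 * s)]
end

section
/- Let n ≥ 2 and let Φ : ℝⁿ → ℂ be a Schwartz function. There is a constant C > 0, depending only on Φ and n, such that for all s ≥ 1, all orthonormal unit vectors e₁, e₂ ∈ ℝⁿ, and every Schwartz function u : ℝⁿ → ℂ: ∫_{ℝⁿ} (1 + ‖ξ‖²)^{1/2} |𝓕(Φu)(ξ)|² dξ ≤ C ∫_{ℝⁿ} |p_ζ(ξ)| |𝓕u(ξ)|² dξ. (Equivalently, ‖Φu‖_{H^{1/2,2}} ≲ ‖u‖_{Ẋ^{1/2}_ζ}.) -/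
open MeasureTheory
open scoped RealInnerProductSpace FourierTransform

theorem min_abs_sub_abs_add_mul_abs_le {q : ℝ} (T x : ℝ) (hq : x ^ 2 - T = q) :
    min |x - √T| |x + √T| * |x| ≤ |q| := by
  subst hq
  have h2 : |x - √T| * |x + √T| = |x ^ 2 - √T ^ 2| := by
    rw [← abs_mul]; ring_nf
  rcases le_total 0 T with hT | hT
  · rw [Real.sq_sqrt hT] at h2
    rw [← h2]
    have hτ := Real.sqrt_nonneg T
    rcases le_total 0 x with hx | hx
    · have : |x| ≤ |x + √T| := by
        rw [abs_of_nonneg hx, abs_of_nonneg (by linarith)]; linarith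
      gcongr
      exact min_le_left _ _
    · have : |x| ≤ |x - √T| := by
        rw [abs_of_nonpos hx, abs_of_nonpos (by linarith)]; linarith
      rw [mul_comm |x - √T|]
      gcongr
      exact min_le_right _ _
  · rw [Real.sqrt_eq_zero'.2 hT]
    simp only [sub_zero, add_zero, min_self]
    rw [← abs_mul, abs_of_nonneg (mul_self_nonneg x), abs_of_nonneg (by nlinarith [sq_nonneg x])]
    nlinarith

theorem exists_ne_le_mul_abs {n : ℕ} (i₀ : Fin n) (y : Fin n → ℝ) {r s : ℝ}
    (hs : 1 ≤ s) (hr : r ^ 2 = ∑ i, y i ^ 2) (h0 : |y i₀| ≤ 1 / 2) (hrs : 3 / 4 * s ≤ r) :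
    ∃ j ≠ i₀, s ≤ 2 * n * |y j| := by
  by_contra! H
  have hn : (1 : ℝ) ≤ n := by
    have := i₀.pos
    exact_mod_cast this
  have h1 : ∀ j ≠ i₀, y j ^ 2 ≤ s ^ 2 / (4 * n) := by
    intro j hj
    have := H j hj
    rw [le_div_iff₀ (by positivity), ← sq_abs]
    have h2 : (2 * n * |y j|) ^ 2 ≤ s ^ 2 := by gcongr
    have h3 : 0 ≤ |y j| ^ 2 * (n * (n - 1)) := by
      have : 0 ≤ (n : ℝ) - 1 := by linarith
      positivity
    nlinarith
  have h2 : ∑ i ∈ Finset.univ.erase i₀, y i ^ 2 ≤ s ^ 2 / 4 := by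
    calc _ ≤ ∑ i ∈ Finset.univ.erase i₀, s ^ 2 / (4 * n) :=
          Finset.sum_le_sum fun i hi => h1 i (Finset.ne_of_mem_erase hi)
      _ ≤ ∑ i : Fin n, s ^ 2 / (4 * n) :=
          Finset.sum_le_sum_of_subset_of_nonneg (Finset.subset_univ _) fun _ _ _ => by positivity
      _ = s ^ 2 / 4 := by
          simp
          field_simp
  have h3 := Finset.add_sum_erase Finset.univ (fun i => y i ^ 2) (Finset.mem_univ i₀)
  have h4 : y i₀ ^ 2 ≤ 1 / 4 := by
    rw [← sq_abs]; nlinarith [abs_nonneg (y i₀)]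
  nlinarith

theorem div_symbol_bound {n : ℕ} (i₀ : Fin n) (y : Fin n → ℝ) {r s : ℝ} (hs : 1 ≤ s)
    (hr0 : 0 ≤ r) (hr : r ^ 2 = ∑ i, y i ^ 2) :
    (r + s) / √((r ^ 2 - s ^ 2) ^ 2 + 4 * s ^ 2 * y i₀ ^ 2) ≤ 4 ∨ ∃ j ≠ i₀,
      ((r + s) / √((r ^ 2 - s ^ 2) ^ 2 + 4 * s ^ 2 * y i₀ ^ 2)) ^ 2 * |y i₀| *
        min |y j - √(s ^ 2 - ∑ i ∈ Finset.univ.erase j, y i ^ 2)|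
          |y j + √(s ^ 2 - ∑ i ∈ Finset.univ.erase j, y i ^ 2)| ≤ (4 * n) ^ 2 := by
  set D := (r ^ 2 - s ^ 2) ^ 2 + 4 * s ^ 2 * y i₀ ^ 2 with hD
  have hD0 : 0 ≤ D := by positivity
  have h1 : |r ^ 2 - s ^ 2| ≤ √D := by
    apply Real.abs_le_sqrt
    nlinarith [mul_nonneg (sq_nonneg s) (sq_nonneg (y i₀))]
  have h2 : 2 * s * |y i₀| ≤ √D := by
    apply Real.le_sqrt_of_sq_le
    rw [mul_pow, sq_abs]
    nlinarith [sq_nonneg (r ^ 2 - s ^ 2)]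
  have h3 : |r ^ 2 - s ^ 2| = |r - s| * (r + s) := by
    rw [← abs_of_nonneg (add_nonneg hr0 (by linarith : (0 : ℝ) ≤ s)), ← abs_mul]; ring_nf
  by_cases ha : 1 / 4 ≤ |r - s|
  · left
    refine div_le_of_le_mul₀ (Real.sqrt_nonneg _) (by norm_num) ?_
    nlinarith
  push Not at ha
  have ha' := abs_lt.1 ha
  by_cases hb : 1 / 2 < |y i₀|
  · left
    refine div_le_of_le_mul₀ (Real.sqrt_nonneg _) (by norm_num) ?_
    nlinarith
  push Not at hb
  right
  obtain ⟨j, hj, hsj⟩ := exists_ne_le_mul_abs i₀ y hs hr hb (by linarith)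
  refine ⟨j, hj, ?_⟩
  set T := s ^ 2 - ∑ i ∈ Finset.univ.erase j, y i ^ 2 with hT
  have h4 := min_abs_sub_abs_add_mul_abs_le T (y j) (q := r ^ 2 - s ^ 2) (by
    rw [hr, ← Finset.add_sum_erase Finset.univ (fun i => y i ^ 2) (Finset.mem_univ j)]
    ring)
  set m := min |y j - √T| |y j + √T|
  have hm : 0 ≤ m := le_min (abs_nonneg _) (abs_nonneg _)
  have hn : (1 : ℝ) ≤ n := by
    have := i₀.pos
    exact_mod_cast this
  have h5 : s ^ 2 * (|y i₀| * m) ≤ n * D := by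
    calc s ^ 2 * (|y i₀| * m) = s * (|y i₀| * m) * s := by ring
      _ ≤ s * (|y i₀| * m) * (2 * n * |y j|) := by gcongr
      _ = n * ((2 * s * |y i₀|) * (m * |y j|)) := by ring
      _ ≤ n * (√D * √D) := by
        gcongr
        exact h4.trans h1
      _ = n * D := by rw [Real.mul_self_sqrt hD0]
  have h6 : (r + s) ^ 2 ≤ 16 * s ^ 2 := by nlinarith
  rw [div_pow, Real.sq_sqrt hD0, mul_assoc, div_mul_eq_mul_div]
  refine div_le_of_le_mul₀ hD0 (by positivity) ?_
  calc (r + s) ^ 2 * (|y i₀| * m) ≤ 16 * s ^ 2 * (|y i₀| * m) := by gcongr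
    _ ≤ 16 * (n * D) := by linarith
    _ ≤ (4 * n) ^ 2 * D := by
      have : 0 ≤ D * (n * (n - 1)) := by
        have : 0 ≤ (n : ℝ) - 1 := by linarith
        positivity
      nlinarith

/-- `|t|^(-1/2)`, with value `∞` at `t = 0`. -/
noncomputable def invSqrtAbs (t : ℝ) : ENNReal := ENNReal.ofReal |t| ^ (-(1 / 2) : ℝ)

/-- The Cauchy weight `1 / (1 + t²)`. -/
noncomputable def cauchyWeight (t : ℝ) : ENNReal := ENNReal.ofReal ((1 + t ^ 2)⁻¹)

@[fun_prop]
theorem measurable_invSqrtAbs : Measurable invSqrtAbs := by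
  unfold invSqrtAbs; fun_prop

@[fun_prop]
theorem measurable_cauchyWeight : Measurable cauchyWeight := by
  unfold cauchyWeight; fun_prop

theorem cauchyWeight_le_one (t : ℝ) : cauchyWeight t ≤ 1 := by
  rw [cauchyWeight, ENNReal.ofReal_le_one]
  exact inv_le_one_of_one_le₀ (by nlinarith [sq_nonneg t])

theorem invSqrtAbs_neg (t : ℝ) : invSqrtAbs (-t) = invSqrtAbs t := by
  simp [invSqrtAbs]

theorem invSqrtAbs_le_one {t : ℝ} (ht : 1 ≤ |t|) : invSqrtAbs t ≤ 1 := by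
  apply ENNReal.rpow_le_one_of_one_le_of_neg _ (by norm_num)
  rwa [ENNReal.one_le_ofReal]

theorem invSqrtAbs_ne_zero (t : ℝ) : invSqrtAbs t ≠ 0 := by
  simp [invSqrtAbs, ENNReal.rpow_eq_zero_iff]

theorem invSqrtAbs_zero : invSqrtAbs 0 = ⊤ := by
  simp [invSqrtAbs]

theorem setLIntegral_invSqrtAbs_ne_top : ∫⁻ t in Set.Icc 0 1, invSqrtAbs t ≠ ⊤ := by
  rw [restrict_Ioc_eq_restrict_Icc.symm]
  have h := (intervalIntegral.intervalIntegrable_rpow' (r := -(1 / 2)) (a := 0) (b := 1)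
    (by norm_num)).1
  rw [IntegrableOn] at h
  have h2 := h.lintegral_lt_top
  refine ne_of_eq_of_ne (setLIntegral_congr_fun measurableSet_Ioc fun t ht => ?_) h2.ne
  simp only [invSqrtAbs]
  rw [abs_of_pos ht.1, ENNReal.ofReal_rpow_of_pos ht.1]

theorem lintegral_cauchyWeight_ne_top : ∫⁻ t, cauchyWeight t ≠ ⊤ :=
  integrable_inv_one_add_sq.lintegral_lt_top.ne

theorem lintegral_cauchyWeight_ne_zero : ∫⁻ t, cauchyWeight t ≠ 0 := by
  intro h
  rw [lintegral_eq_zero_iff measurable_cauchyWeight] at h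
  obtain ⟨t, ht⟩ := Filter.Eventually.exists h
  simp only [cauchyWeight, Pi.zero_apply, ENNReal.ofReal_eq_zero] at ht
  have : 0 < (1 + t ^ 2)⁻¹ := by positivity
  linarith

theorem exists_lintegral_cauchyWeight_mul_invSqrtAbs_le :
    ∃ K : ENNReal, K ≠ ⊤ ∧ ∀ c a : ℝ, ∫⁻ t, cauchyWeight (t - c) * invSqrtAbs (t - a) ≤ K := by
  set k : ℝ → ENNReal := (Set.Icc 0 1).indicator invSqrtAbs with hk
  have hkm : Measurable k := measurable_invSqrtAbs.indicator measurableSet_Icc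
  refine ⟨(∫⁻ t, k t) + (∫⁻ t, k t) + ∫⁻ t, cauchyWeight t, ?_, fun c a => ?_⟩
  · rw [hk, lintegral_indicator measurableSet_Icc]
    simp [setLIntegral_invSqrtAbs_ne_top, lintegral_cauchyWeight_ne_top]
  calc ∫⁻ t, cauchyWeight (t - c) * invSqrtAbs (t - a)
      ≤ ∫⁻ t, k (t - a) + k (-(t - a)) + cauchyWeight (t - c) := by
        refine lintegral_mono fun t => ?_
        simp only
        by_cases h1 : 1 ≤ |t - a|
        · exact (mul_le_of_le_one_right' (invSqrtAbs_le_one h1)).trans le_add_self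
        · refine (mul_le_of_le_one_left' (cauchyWeight_le_one _)).trans
            (le_trans ?_ le_self_add)
          have h2 := abs_lt.1 (not_le.1 h1)
          rcases le_total 0 (t - a) with h | h
          · refine le_trans ?_ le_self_add
            rw [hk, Set.indicator_of_mem (Set.mem_Icc.2 ⟨h, h2.2.le⟩)]
          · refine le_trans ?_ le_add_self
            rw [hk, Set.indicator_of_mem (Set.mem_Icc.2 ⟨by linarith, by linarith⟩), invSqrtAbs_neg]
    _ = _ := by
      rw [lintegral_add_right _ (by fun_prop), lintegral_add_right _ (by fun_prop),
        lintegral_sub_right_eq_self (fun t => k t), lintegral_sub_right_eq_self (fun t => k (-t)),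
        lintegral_sub_right_eq_self (fun t => cauchyWeight t), lintegral_neg_eq_self]

theorem lintegral_prod_cauchyWeight_mul_invSqrtAbs_le {n : ℕ} {K : ENNReal}
    (hK : ∀ c a : ℝ, ∫⁻ t, cauchyWeight (t - c) * invSqrtAbs (t - a) ≤ K)
    (c : Fin n → ℝ) (j : Fin n) {τ : (Fin n → ℝ) → ℝ} (hτ : Measurable τ)
    (hτj : ∀ y t, τ (Function.update y j t) = τ y) {H : (Fin n → ℝ) → ENNReal} (hH : Measurable H)
    (hHj : ∀ y t, H (Function.update y j t) = H y) :
    ∫⁻ y, (∏ i, cauchyWeight (y i - c i)) * (invSqrtAbs (y j - τ y) * H y) ≤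
      K / (∫⁻ t, cauchyWeight t) * ∫⁻ y, (∏ i, cauchyWeight (y i - c i)) * H y := by
  set G := ∫⁻ t, cauchyWeight t
  rw [← lintegral_const_mul _ (by fun_prop)]
  refine lintegral_le_of_lmarginal_le {j} (by fun_prop) (by fun_prop) fun x => ?_
  rw [lmarginal_singleton, lmarginal_singleton]
  have hprod : ∀ t, ∏ i, cauchyWeight (Function.update x j t i - c i) =
      cauchyWeight (t - c j) * ∏ i ∈ Finset.univ.erase j, cauchyWeight (x i - c i) := fun t => by
    rw [← Finset.mul_prod_erase _ _ (Finset.mem_univ j), Function.update_self]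
    congr 1
    refine Finset.prod_congr rfl fun i hi => ?_
    rw [Function.update_of_ne (Finset.ne_of_mem_erase hi)]
  simp only [hprod, hτj, hHj, Function.update_self]
  set P := ∏ i ∈ Finset.univ.erase j, cauchyWeight (x i - c i)
  calc ∫⁻ t, cauchyWeight (t - c j) * P * (invSqrtAbs (t - τ x) * H x)
      = (∫⁻ t, cauchyWeight (t - c j) * invSqrtAbs (t - τ x)) * (P * H x) := by
        rw [← lintegral_mul_const _ (by fun_prop)]
        congr with t
        ring
    _ ≤ K * (P * H x) := by gcongr; exact hK _ _
    _ = ∫⁻ t, K / G * (cauchyWeight (t - c j) * P * H x) := by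
        simp_rw [mul_assoc]
        rw [lintegral_const_mul _ (by fun_prop), lintegral_mul_const _ (by fun_prop),
          lintegral_sub_right_eq_self (fun t => cauchyWeight t), ← mul_assoc (K / G),
          ENNReal.div_mul_cancel lintegral_cauchyWeight_ne_zero lintegral_cauchyWeight_ne_top]

theorem lintegral_prod_cauchyWeight_ne_top (n : ℕ) :
    ∫⁻ y : Fin n → ℝ, ∏ i, cauchyWeight (y i) ≠ ⊤ := by
  have h : Integrable fun y : Fin n → ℝ => ∏ i, (1 + y i ^ 2)⁻¹ :=
    Integrable.fintype_prod fun _ => integrable_inv_one_add_sq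
  refine ne_of_eq_of_ne (lintegral_congr fun y => ?_) h.lintegral_lt_top.ne
  simp only [cauchyWeight]
  rw [ENNReal.ofReal_prod_of_nonneg fun i _ => by positivity]

theorem lintegral_prod_cauchyWeight_sub {n : ℕ} (c : Fin n → ℝ) :
    ∫⁻ y : Fin n → ℝ, ∏ i, cauchyWeight (y i - c i) =
      ∫⁻ y : Fin n → ℝ, ∏ i, cauchyWeight (y i) :=
  lintegral_sub_right_eq_self (fun y : Fin n → ℝ => ∏ i, cauchyWeight (y i)) c

theorem ofReal_le_mul_invSqrtAbs {X a b K : ℝ} (hK : 0 < K) (h : X ^ 2 * |a| * |b| ≤ K ^ 2) :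
    ENNReal.ofReal X ≤ ENNReal.ofReal K * (invSqrtAbs b * invSqrtAbs a) := by
  have hK' : ENNReal.ofReal K ≠ 0 := by simpa
  rcases eq_or_ne a 0 with rfl | ha
  · simp [invSqrtAbs_zero, ENNReal.mul_top, hK', invSqrtAbs_ne_zero]
  rcases eq_or_ne b 0 with rfl | hb
  · simp [invSqrtAbs_zero, ENNReal.mul_top, ENNReal.top_mul, hK', invSqrtAbs_ne_zero]
  have ha' := abs_pos.2 ha
  have hb' := abs_pos.2 hb
  rw [invSqrtAbs, invSqrtAbs, ENNReal.ofReal_rpow_of_pos ha', ENNReal.ofReal_rpow_of_pos hb',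
    ← ENNReal.ofReal_mul (by positivity), ← ENNReal.ofReal_mul hK.le]
  apply ENNReal.ofReal_le_ofReal
  rw [Real.rpow_neg ha'.le, Real.rpow_neg hb'.le, ← Real.sqrt_eq_rpow, ← Real.sqrt_eq_rpow,
    ← mul_inv, ← div_eq_mul_inv, le_div_iff₀ (by positivity)]
  refine le_of_sq_le_sq ?_ hK.le
  rw [mul_pow, mul_pow, Real.sq_sqrt ha'.le, Real.sq_sqrt hb'.le]
  linarith

theorem ofReal_div_symbol_le {n : ℕ} (i₀ : Fin n) (y : Fin n → ℝ) {r s : ℝ} (hs : 1 ≤ s)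
    (hr0 : 0 ≤ r) (hr : r ^ 2 = ∑ i, y i ^ 2) :
    ENNReal.ofReal ((r + s) / √((r ^ 2 - s ^ 2) ^ 2 + 4 * s ^ 2 * y i₀ ^ 2)) ≤
      4 + ∑ j ∈ Finset.univ.erase i₀, ENNReal.ofReal (4 * n) *
        (invSqrtAbs (y j - √(s ^ 2 - ∑ i ∈ Finset.univ.erase j, y i ^ 2)) * invSqrtAbs (y i₀) +
         invSqrtAbs (y j - -√(s ^ 2 - ∑ i ∈ Finset.univ.erase j, y i ^ 2)) *
          invSqrtAbs (y i₀)) := by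
  have hn : (0 : ℝ) < 4 * n := by
    have := i₀.pos
    positivity
  rcases div_symbol_bound i₀ y hs hr0 hr with h | ⟨j, hj, h⟩
  · refine le_trans ?_ le_self_add
    simpa using ENNReal.ofReal_le_ofReal h
  · refine le_trans ?_ le_add_self
    refine le_trans ?_ (Finset.single_le_sum (fun _ _ => zero_le)
      (Finset.mem_erase.2 ⟨hj, Finset.mem_univ j⟩))
    rw [mul_add]
    rcases min_cases |y j - √(s ^ 2 - ∑ i ∈ Finset.univ.erase j, y i ^ 2)|
      |y j + √(s ^ 2 - ∑ i ∈ Finset.univ.erase j, y i ^ 2)| with hm | hm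
    · rw [hm.1] at h
      exact (ofReal_le_mul_invSqrtAbs hn h).trans le_self_add
    · rw [hm.1] at h
      rw [sub_neg_eq_add]
      exact (ofReal_le_mul_invSqrtAbs hn h).trans le_add_self

theorem exists_lintegral_prod_cauchyWeight_mul_symbol_le {n : ℕ} (i₀ : Fin n) :
    ∃ K : ENNReal, K ≠ ⊤ ∧ ∀ s ≥ (1 : ℝ), ∀ c : Fin n → ℝ,
      ∫⁻ y : Fin n → ℝ, (∏ i, cauchyWeight (y i - c i)) *
        ENNReal.ofReal ((√(∑ i, y i ^ 2) + s) /
          √((√(∑ i, y i ^ 2) ^ 2 - s ^ 2) ^ 2 + 4 * s ^ 2 * y i₀ ^ 2)) ≤ K := by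
  obtain ⟨K, hKt, hK⟩ := exists_lintegral_cauchyWeight_mul_invSqrtAbs_le
  set L := K / ∫⁻ t, cauchyWeight t
  have hL : L ≠ ⊤ := ENNReal.div_ne_top hKt lintegral_cauchyWeight_ne_zero
  set I := ∫⁻ y : Fin n → ℝ, ∏ i, cauchyWeight (y i)
  have hI : I ≠ ⊤ := lintegral_prod_cauchyWeight_ne_top n
  refine ⟨4 * I + ∑ j ∈ Finset.univ.erase i₀, ENNReal.ofReal (4 * n) *
    (L * (L * I) + L * (L * I)), ?_, fun s hs c => ?_⟩
  · refine ENNReal.add_ne_top.2 ⟨by finiteness, ENNReal.sum_ne_top.2 fun j _ => by finiteness⟩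
  have key : ∀ j ≠ i₀, ∀ τ : (Fin n → ℝ) → ℝ, Measurable τ →
      (∀ y t, τ (Function.update y j t) = τ y) →
      ∫⁻ y, (∏ i, cauchyWeight (y i - c i)) * (invSqrtAbs (y j - τ y) * invSqrtAbs (y i₀)) ≤
        L * (L * I) := by
    intro j hj τ hτ hτj
    refine (lintegral_prod_cauchyWeight_mul_invSqrtAbs_le hK c j hτ hτj
      (H := fun y => invSqrtAbs (y i₀)) (by fun_prop)
      fun y t => by rw [Function.update_of_ne hj.symm]).trans ?_
    gcongr
    have := lintegral_prod_cauchyWeight_mul_invSqrtAbs_le hK c i₀ (τ := fun _ => 0)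
      (by fun_prop) (fun _ _ => rfl) (H := fun _ => 1) (by fun_prop) (fun _ _ => rfl)
    simpa only [sub_zero, mul_one, lintegral_prod_cauchyWeight_sub] using! this
  set T : Fin n → (Fin n → ℝ) → ℝ := fun j y => √(s ^ 2 - ∑ i ∈ Finset.univ.erase j, y i ^ 2)
    with hT
  have hTm : ∀ j, Measurable (T j) := fun j => by fun_prop
  have hTj : ∀ j y t, T j (Function.update y j t) = T j y := fun j y t => by
    simp only [hT]
    congr 2
    refine Finset.sum_congr rfl fun i hi => ?_
    rw [Function.update_of_ne (Finset.ne_of_mem_erase hi)]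
  calc _ ≤ ∫⁻ y : Fin n → ℝ, (∏ i, cauchyWeight (y i - c i)) * 4 +
        ∑ j ∈ Finset.univ.erase i₀, ENNReal.ofReal (4 * n) *
        ((∏ i, cauchyWeight (y i - c i)) * (invSqrtAbs (y j - T j y) * invSqrtAbs (y i₀)) +
         (∏ i, cauchyWeight (y i - c i)) *
          (invSqrtAbs (y j - -T j y) * invSqrtAbs (y i₀))) := by
        refine lintegral_mono fun y => ?_
        refine (mul_le_mul_right (ofReal_div_symbol_le i₀ y hs (Real.sqrt_nonneg _)
          (Real.sq_sqrt (by positivity))) _).trans_eq ?_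
        rw [mul_add, Finset.mul_sum]
        congr 1
        refine Finset.sum_congr rfl fun j _ => ?_
        ring
    _ ≤ _ := by
      rw [lintegral_add_left (by fun_prop), lintegral_mul_const _ (by fun_prop),
        lintegral_prod_cauchyWeight_sub, mul_comm, lintegral_finsetSum _ (fun j _ => by fun_prop)]
      gcongr with j hj
      have hj' := Finset.ne_of_mem_erase hj
      rw [lintegral_const_mul _ (by fun_prop), lintegral_add_left (by fun_prop)]
      gcongr
      · exact key j hj' _ (hTm j) (hTj j)
      · exact key j hj' (fun y => -T j y) (hTm j).neg fun y t => by rw [hTj]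

theorem pAbs_eq_sub {n : ℕ} (s : ℝ) {e₁ e₂ : EuclideanSpace ℝ (Fin n)} (h2 : ‖e₂‖ = 1)
    (h12 : ⟪e₁, e₂⟫ = 0) (η : EuclideanSpace ℝ (Fin n)) :
    pAbs s e₁ e₂ η =
      √((‖η - s • e₂‖ ^ 2 - s ^ 2) ^ 2 + 4 * s ^ 2 * ⟪e₁, η - s • e₂⟫ ^ 2) := by
  rw [pAbs, norm_sub_sq_real, inner_sub_right, inner_smul_right, inner_smul_right, h12,
    norm_smul, h2, real_inner_comm e₂ η, mul_one, Real.norm_eq_abs, sq_abs]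
  ring_nf

theorem inv_one_add_norm_sq_pow_le {n : ℕ} (x : EuclideanSpace ℝ (Fin n)) :
    ENNReal.ofReal (((1 + ‖x‖ ^ 2) ^ n)⁻¹) ≤ ∏ i, cauchyWeight (x i) := by
  simp only [cauchyWeight]
  rw [← ENNReal.ofReal_prod_of_nonneg fun i _ => by positivity]
  apply ENNReal.ofReal_le_ofReal
  rw [← inv_pow]
  calc ((1 + ‖x‖ ^ 2)⁻¹) ^ n = ∏ i : Fin n, (1 + ‖x‖ ^ 2)⁻¹ := by simp
    _ ≤ _ := by
      refine Finset.prod_le_prod (fun _ _ => by positivity) fun i _ =>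
        inv_anti₀ (by positivity) ?_
      rw [← sq_abs (x i), ← Real.norm_eq_abs]
      grw [PiLp.norm_apply_le x i]

theorem exists_lintegral_div_pAbs_le {n : ℕ} (hn : 0 < n) :
    ∃ K : ENNReal, K ≠ ⊤ ∧ ∀ s ≥ (1 : ℝ), ∀ e₁ e₂ : EuclideanSpace ℝ (Fin n),
      ‖e₁‖ = 1 → ‖e₂‖ = 1 → ⟪e₁, e₂⟫ = 0 → ∀ ξ : EuclideanSpace ℝ (Fin n),
      ∫⁻ η, ENNReal.ofReal (((1 + ‖η - ξ‖ ^ 2) ^ n)⁻¹) *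
        ENNReal.ofReal ((‖η - s • e₂‖ + s) / pAbs s e₁ e₂ η) ≤ K := by
  set i₀ : Fin n := ⟨0, hn⟩
  obtain ⟨K, hKt, hK⟩ := exists_lintegral_prod_cauchyWeight_mul_symbol_le i₀
  refine ⟨K, hKt, fun s hs e₁ e₂ h1 h2 h12 ξ => ?_⟩
  obtain ⟨b, hb⟩ : ∃ b : OrthonormalBasis (Fin n) ℝ (EuclideanSpace ℝ (Fin n)), b i₀ = e₁ := by
    obtain ⟨b, hb⟩ := Orthonormal.exists_orthonormalBasis_extension_of_card_eq (𝕜 := ℝ)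
      (E := EuclideanSpace ℝ (Fin n)) (ι := Fin n) (by simp) (v := fun _ => e₁) (s := {i₀})
      ⟨fun _ => h1, fun i j hij => (hij (Subsingleton.elim i j)).elim⟩
    exact ⟨b, hb i₀ rfl⟩
  set F : EuclideanSpace ℝ (Fin n) → ENNReal := fun z =>
    ENNReal.ofReal (((1 + ‖z - (ξ - s • e₂)‖ ^ 2) ^ n)⁻¹) *
      ENNReal.ofReal ((‖z‖ + s) / √((‖z‖ ^ 2 - s ^ 2) ^ 2 + 4 * s ^ 2 * ⟪e₁, z⟫ ^ 2)) with hF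
  have hFm : Measurable F := by fun_prop
  calc _ = ∫⁻ η, F (η - s • e₂) := by
        refine lintegral_congr fun η => ?_
        simp only [hF]
        rw [pAbs_eq_sub s h2 h12, sub_sub_sub_cancel_right]
    _ = ∫⁻ z, F z := lintegral_sub_right_eq_self F _
    _ = ∫⁻ y : Fin n → ℝ, F (b.repr.symm (WithLp.toLp 2 y)) := by
        rw [← b.measurePreserving_repr_symm.lintegral_comp hFm]
        exact ((PiLp.volume_preserving_toLp (Fin n)).lintegral_comp
          (hFm.comp b.repr.symm.continuous.measurable)).symm
    _ ≤ _ := ?_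
  refine le_trans (lintegral_mono fun y => ?_) (hK s hs fun i => b.repr (ξ - s • e₂) i)
  have hz : ‖b.repr.symm (WithLp.toLp 2 y)‖ = √(∑ i, y i ^ 2) := by
    rw [LinearIsometryEquiv.norm_map, EuclideanSpace.norm_eq]
    simp
  have hi : ⟪e₁, b.repr.symm (WithLp.toLp 2 y)⟫ = y i₀ := by
    rw [← hb, ← b.repr_apply_apply]
    simp
  simp only [hF, hz, hi]
  gcongr
  rw [← b.repr.norm_map (_ - _), map_sub, LinearIsometryEquiv.apply_symm_apply]
  exact inv_one_add_norm_sq_pow_le _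

theorem sq_lintegral_le_mul_of_sq_le {α : Type*} [MeasurableSpace α] {μ : Measure α}
    {A B G : α → ENNReal} (hA : Measurable A) (hB : Measurable B)
    (h : ∀ᵐ x ∂μ, G x ^ 2 ≤ A x * B x) :
    (∫⁻ x, G x ∂μ) ^ 2 ≤ (∫⁻ x, A x ∂μ) * ∫⁻ x, B x ∂μ := by
  have hsq : ∀ x : ENNReal, (x ^ (1 / 2 : ℝ)) ^ 2 = x := fun x => by
    rw [← ENNReal.rpow_natCast, ← ENNReal.rpow_mul]; norm_num
  have hsq' : ∀ x : ENNReal, (x ^ (1 / 2 : ℝ)) ^ (2 : ℝ) = x := fun x => by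
    rw [← ENNReal.rpow_mul]; norm_num
  have h1 : ∫⁻ x, G x ∂μ ≤
      ∫⁻ x, ((fun x => A x ^ (1 / 2 : ℝ)) * fun x => B x ^ (1 / 2 : ℝ)) x ∂μ := by
    refine lintegral_mono_ae (h.mono fun x hx => ?_)
    rw [← ENNReal.pow_le_pow_left_iff two_ne_zero, Pi.mul_apply, mul_pow, hsq, hsq]
    exact hx
  have h2 := h1.trans (ENNReal.lintegral_mul_le_Lp_mul_Lq μ Real.HolderConjugate.two_two
    (hA.pow_const _).aemeasurable (hB.pow_const _).aemeasurable)
  simp only [hsq'] at h2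
  calc _ ≤ _ := pow_le_pow_left₀ zero_le h2 2
    _ = _ := by rw [mul_pow, hsq, hsq]

theorem SchwartzMap.fourier_mul_eq_integral {n : ℕ} (Φ u : SchwartzMap (EuclideanSpace ℝ (Fin n)) ℂ)
    (ξ : EuclideanSpace ℝ (Fin n)) :
    𝓕 (fun x => Φ x * u x) ξ = ∫ η, 𝓕 (⇑Φ) (ξ - η) * 𝓕 (⇑u) η := by
  have h1 : 𝓕 (convolution (ContinuousLinearMap.mul ℂ ℂ) (𝓕⁻ Φ) (𝓕⁻ u)) =
      pairing (ContinuousLinearMap.mul ℂ ℂ) Φ u := by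
    rw [fourier_convolution]; simp
  have h2 : 𝓕⁻ (pairing (ContinuousLinearMap.mul ℂ ℂ) Φ u) =
      convolution (ContinuousLinearMap.mul ℂ ℂ) (𝓕⁻ Φ) (𝓕⁻ u) := by
    rw [← h1]; simp
  have h3 : 𝓕 (fun x => Φ x * u x) ξ =
      𝓕⁻ (pairing (ContinuousLinearMap.mul ℂ ℂ) Φ u) (-ξ) := by
    rw [fourierInv_coe, Real.fourierInv_eq_fourier_neg, neg_neg]
    rfl
  rw [h3, h2, convolution_apply, MeasureTheory.convolution_def,
    ← integral_sub_right_eq_self _ ξ]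
  refine integral_congr_ae (Filter.Eventually.of_forall fun η => ?_)
  simp only [ContinuousLinearMap.mul_apply', fourierInv_coe, Real.fourierInv_eq_fourier_neg]
  congr 2 <;> abel_nf

theorem SchwartzMap.exists_norm_le_inv_one_add_sq_pow {n : ℕ} (k : ℕ)
    (f : SchwartzMap (EuclideanSpace ℝ (Fin n)) ℂ) :
    ∃ M > 0, ∀ x, ‖f x‖ ≤ M * ((1 + ‖x‖ ^ 2) ^ k)⁻¹ := by
  set M := 2 ^ (2 * k) * (Finset.Iic (2 * k, 0)).sup (fun m => SchwartzMap.seminorm ℝ m.1 m.2) f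
  have hM : 0 ≤ M := by positivity
  refine ⟨M + 1, by positivity, fun x => ?_⟩
  have h := f.one_add_le_sup_seminorm_apply (𝕜 := ℝ) (m := (2 * k, 0)) le_rfl le_rfl x
  rw [norm_iteratedFDeriv_zero] at h
  rw [← div_eq_mul_inv, le_div_iff₀ (by positivity), mul_comm]
  calc (1 + ‖x‖ ^ 2) ^ k * ‖f x‖ ≤ ((1 + ‖x‖) ^ 2) ^ k * ‖f x‖ := by
        gcongr; nlinarith [norm_nonneg x]
    _ = (1 + ‖x‖) ^ (2 * k) * ‖f x‖ := by rw [pow_mul]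
    _ ≤ M := h
    _ ≤ M + 1 := by linarith

theorem measurable_pAbs {n : ℕ} (s : ℝ) (e₁ e₂ : EuclideanSpace ℝ (Fin n)) :
    Measurable (pAbs s e₁ e₂) := by
  unfold pAbs; fun_prop

theorem ae_pAbs_pos {n : ℕ} {s : ℝ} (hs : s ≠ 0) {e₁ e₂ : EuclideanSpace ℝ (Fin n)}
    (h1 : e₁ ≠ 0) : ∀ᵐ η, 0 < pAbs s e₁ e₂ η := by
  have h : volume ((ℝ ∙ e₁)ᗮ : Set (EuclideanSpace ℝ (Fin n))) = 0 := by
    refine Measure.addHaar_submodule _ _ fun htop => h1 ?_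
    have : e₁ ∈ (ℝ ∙ e₁)ᗮ := htop ▸ Submodule.mem_top
    exact inner_self_eq_zero.1 (Submodule.mem_orthogonal_singleton_iff_inner_right.1 this)
  filter_upwards [compl_mem_ae_iff.2 h] with η hη
  have hη : ⟪e₁, η⟫ ≠ 0 := fun h0 =>
    hη (Submodule.mem_orthogonal_singleton_iff_inner_right.2 h0)
  apply Real.sqrt_pos.2
  positivity

theorem pAbs_le {n : ℕ} {s : ℝ} (hs : 0 ≤ s) {e₁ e₂ : EuclideanSpace ℝ (Fin n)}
    (h1 : ‖e₁‖ = 1) (h2 : ‖e₂‖ = 1) (η : EuclideanSpace ℝ (Fin n)) :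
    pAbs s e₁ e₂ η ≤ ‖η‖ ^ 2 + 4 * s * ‖η‖ := by
  have i1 : |⟪e₁, η⟫| ≤ ‖η‖ := by simpa [h1] using abs_real_inner_le_norm e₁ η
  have i2 : |⟪e₂, η⟫| ≤ ‖η‖ := by simpa [h2] using abs_real_inner_le_norm e₂ η
  have a1 : |‖η‖ ^ 2 - 2 * s * ⟪e₂, η⟫| ≤ ‖η‖ ^ 2 + 2 * s * ‖η‖ := by
    have := abs_le.1 i2
    rw [abs_le]
    constructor <;> nlinarith [sq_nonneg ‖η‖]
  have a2 : 4 * s ^ 2 * ⟪e₁, η⟫ ^ 2 ≤ (2 * s * ‖η‖) ^ 2 := by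
    rw [← sq_abs ⟪e₁, η⟫]
    have : |⟪e₁, η⟫| ^ 2 ≤ ‖η‖ ^ 2 := by gcongr
    nlinarith [sq_nonneg s]
  have a3 : (‖η‖ ^ 2 - 2 * s * ⟪e₂, η⟫) ^ 2 ≤ (‖η‖ ^ 2 + 2 * s * ‖η‖) ^ 2 := by
    rw [← sq_abs (_ - _)]; gcongr
  refine Real.sqrt_le_iff.2 ⟨by positivity, ?_⟩
  have : 0 ≤ (‖η‖ ^ 2 + 2 * s * ‖η‖) * (2 * s * ‖η‖) := by positivity
  nlinarith

theorem integrable_pAbs_mul_sq {n : ℕ} {s : ℝ} (hs : 0 ≤ s) {e₁ e₂ : EuclideanSpace ℝ (Fin n)}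
    (h1 : ‖e₁‖ = 1) (h2 : ‖e₂‖ = 1) (f : SchwartzMap (EuclideanSpace ℝ (Fin n)) ℂ) :
    Integrable fun ξ => pAbs s e₁ e₂ ξ * ‖f ξ‖ ^ 2 := by
  have hint := ((f.integrable_pow_mul volume 2).add
    ((f.integrable_pow_mul volume 1).const_mul (4 * s))).const_mul (SchwartzMap.seminorm ℝ 0 0 f)
  refine hint.mono' ((measurable_pAbs s e₁ e₂).mul
    (f.continuous.measurable.norm.pow_const 2)).aestronglyMeasurable
    (Filter.Eventually.of_forall fun ξ => ?_)
  have hp : 0 ≤ pAbs s e₁ e₂ ξ := Real.sqrt_nonneg _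
  rw [Real.norm_of_nonneg (by positivity)]
  calc pAbs s e₁ e₂ ξ * ‖f ξ‖ ^ 2
      ≤ (‖ξ‖ ^ 2 + 4 * s * ‖ξ‖) * (SchwartzMap.seminorm ℝ 0 0 f * ‖f ξ‖) := by
        rw [sq ‖f ξ‖]
        gcongr
        · exact pAbs_le hs h1 h2 ξ
        · exact f.norm_le_seminorm ℝ ξ
    _ = _ := by simp only [Pi.add_apply]; ring

theorem sqrt_one_add_norm_sq_mul_le {n : ℕ} {s : ℝ} (hs : 1 ≤ s)
    {e₂ : EuclideanSpace ℝ (Fin n)} (h2 : ‖e₂‖ = 1) (ξ η : EuclideanSpace ℝ (Fin n)) :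
    √(1 + ‖ξ‖ ^ 2) * ((1 + ‖η - ξ‖ ^ 2) ^ (n + 1))⁻¹ ≤
      4 * ((1 + ‖η - ξ‖ ^ 2) ^ n)⁻¹ * (‖η - s • e₂‖ + s) := by
  have a1 : √(1 + ‖ξ‖ ^ 2) ≤ 1 + ‖ξ‖ :=
    Real.sqrt_le_iff.2 ⟨by positivity, by nlinarith [norm_nonneg ξ]⟩
  have a2 : ‖ξ‖ ≤ ‖η‖ + ‖η - ξ‖ := by
    simpa using norm_sub_le η (η - ξ)
  have a3 : ‖η‖ ≤ ‖η - s • e₂‖ + s := by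
    have := norm_add_le (η - s • e₂) (s • e₂)
    rwa [sub_add_cancel, norm_smul, h2, mul_one, Real.norm_of_nonneg (by linarith)] at this
  have a4 : √(1 + ‖ξ‖ ^ 2) ≤ 4 * (1 + ‖η - ξ‖ ^ 2) * (‖η - s • e₂‖ + s) := by
    set t := ‖η - ξ‖
    set v := ‖η - s • e₂‖ + s
    have hv : 1 ≤ v := by linarith [norm_nonneg (η - s • e₂)]
    have ht : 0 ≤ t := norm_nonneg _
    have b1 : 1 + t ≤ 2 * (1 + t ^ 2) := by nlinarith [sq_nonneg (t - 1)]
    calc _ ≤ (1 + t) * (2 * v) := by nlinarith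
      _ ≤ 2 * (1 + t ^ 2) * (2 * v) := by gcongr
      _ = _ := by ring
  calc _ ≤ 4 * (1 + ‖η - ξ‖ ^ 2) * (‖η - s • e₂‖ + s) * ((1 + ‖η - ξ‖ ^ 2) ^ (n + 1))⁻¹ := by
        gcongr
    _ = _ := by
      field_simp
      ring

theorem exists_lintegral_sqrt_mul_inv_pAbs_le {n : ℕ} (hn : 0 < n) :
    ∃ K : ENNReal, K ≠ ⊤ ∧ ∀ s ≥ (1 : ℝ), ∀ e₁ e₂ : EuclideanSpace ℝ (Fin n),
      ‖e₁‖ = 1 → ‖e₂‖ = 1 → ⟪e₁, e₂⟫ = 0 → ∀ ξ : EuclideanSpace ℝ (Fin n),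
      ENNReal.ofReal √(1 + ‖ξ‖ ^ 2) * ∫⁻ η, ENNReal.ofReal (((1 + ‖η - ξ‖ ^ 2) ^ (n + 1))⁻¹) *
        ENNReal.ofReal (pAbs s e₁ e₂ η)⁻¹ ≤ K := by
  obtain ⟨K, hKt, hK⟩ := exists_lintegral_div_pAbs_le hn
  refine ⟨4 * K, by finiteness, fun s hs e₁ e₂ h1 h2 h12 ξ => ?_⟩
  have hm := measurable_pAbs s e₁ e₂
  grw [← hK s hs e₁ e₂ h1 h2 h12 ξ]
  rw [← lintegral_const_mul _ (by fun_prop), ← lintegral_const_mul _ (by fun_prop)]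
  refine lintegral_mono fun η => ?_
  have hp : 0 ≤ pAbs s e₁ e₂ η := Real.sqrt_nonneg _
  rw [show (4 : ENNReal) = ENNReal.ofReal 4 by simp, ← ENNReal.ofReal_mul (by positivity),
    ← ENNReal.ofReal_mul (by positivity), ← ENNReal.ofReal_mul (by positivity),
    ← ENNReal.ofReal_mul (by positivity)]
  apply ENNReal.ofReal_le_ofReal
  have := sqrt_one_add_norm_sq_mul_le hs h2 ξ η
  calc _ = √(1 + ‖ξ‖ ^ 2) * ((1 + ‖η - ξ‖ ^ 2) ^ (n + 1))⁻¹ * (pAbs s e₁ e₂ η)⁻¹ := by ring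
    _ ≤ _ := mul_le_mul_of_nonneg_right this (by positivity)
    _ = _ := by rw [div_eq_mul_inv]; ring

theorem lintegral_inv_one_add_norm_sq_pow_ne_top (n : ℕ) :
    ∫⁻ x : EuclideanSpace ℝ (Fin n), ENNReal.ofReal (((1 + ‖x‖ ^ 2) ^ (n + 1))⁻¹) ≠ ⊤ := by
  have h := integrable_rpow_neg_one_add_norm_sq (E := EuclideanSpace ℝ (Fin n)) (μ := volume)
    (r := 2 * (n + 1)) (by simp; linarith)
  refine ne_of_eq_of_ne (lintegral_congr fun x => ?_) h.lintegral_lt_top.ne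
  rw [show (-(2 * ((n : ℝ) + 1)) / 2) = -((n + 1 : ℕ) : ℝ) by push_cast; ring,
    Real.rpow_neg (by positivity), Real.rpow_natCast]

/-- `‖Φu‖_{H^{1/2,2}} ≲ ‖u‖_{Ẋ^{1/2}_ζ}` uniformly over `s ≥ 1` and
orthonormal `e₁, e₂`, for a fixed Schwartz cutoff `Φ`. -/
theorem stmt_10 (n : ℕ) (hn : 2 ≤ n)
    (Φ : SchwartzMap (EuclideanSpace ℝ (Fin n)) ℂ) :
    ∃ C > 0, ∀ s ≥ (1 : ℝ), ∀ e₁ e₂ : EuclideanSpace ℝ (Fin n),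
      ‖e₁‖ = 1 → ‖e₂‖ = 1 → ⟪e₁, e₂⟫ = 0 →
      ∀ u : SchwartzMap (EuclideanSpace ℝ (Fin n)) ℂ,
        ∫ ξ, Real.sqrt (1 + ‖ξ‖ ^ 2) * ‖𝓕 (fun x => Φ x * u x) ξ‖ ^ 2 ≤ C * ∫ ξ, pAbs s e₁ e₂ ξ * ‖𝓕 (⇑u) ξ‖ ^ 2 := by
  obtain ⟨K, hKt, hK⟩ := exists_lintegral_sqrt_mul_inv_pAbs_le (n := n) (by omega)
  obtain ⟨M, hM0, hM⟩ := (𝓕 Φ).exists_norm_le_inv_one_add_sq_pow (n + 1)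
  set w : EuclideanSpace ℝ (Fin n) → ENNReal :=
    fun x => ENNReal.ofReal (((1 + ‖x‖ ^ 2) ^ (n + 1))⁻¹) with hw
  have hwm : Measurable w := by fun_prop
  set I := ∫⁻ x, w x with hI
  have hIt : I ≠ ⊤ := lintegral_inv_one_add_norm_sq_pow_ne_top n
  set m := ENNReal.ofReal M
  set D := m ^ 2 * K * I with hD
  have hDt : D ≠ ⊤ := by finiteness
  refine ⟨D.toReal + 1, by positivity, fun s hs e₁ e₂ h1 h2 h12 u => ?_⟩
  have hpm := measurable_pAbs s e₁ e₂
  have hp0 : ∀ η, 0 ≤ pAbs s e₁ e₂ η := fun η => Real.sqrt_nonneg _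
  have hint : Integrable fun ξ => pAbs s e₁ e₂ ξ * ‖𝓕 (⇑u) ξ‖ ^ 2 :=
    integrable_pAbs_mul_sq (zero_le_one.trans hs) h1 h2 (𝓕 u)
  have hum : Measurable (𝓕 (⇑u)) := (𝓕 u).continuous.measurable
  set P : EuclideanSpace ℝ (Fin n) → ENNReal :=
    fun η => ENNReal.ofReal (pAbs s e₁ e₂ η) * ‖𝓕 (⇑u) η‖ₑ ^ 2 with hP
  have hPm : Measurable P := by fun_prop
  have hPR : ∀ ξ, ENNReal.ofReal (pAbs s e₁ e₂ ξ * ‖𝓕 (⇑u) ξ‖ ^ 2) = P ξ := fun ξ => by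
    rw [ENNReal.ofReal_mul (hp0 ξ), ENNReal.ofReal_pow (norm_nonneg _), ofReal_norm]
  have hΦ : ∀ x, ‖𝓕 (⇑Φ) (-x)‖ₑ ≤ m * w x := fun x => by
    rw [← ofReal_norm, hw, ← ENNReal.ofReal_mul hM0.le, ← norm_neg x]
    exact ENNReal.ofReal_le_ofReal (hM (-x))
  have hconv : ∀ ξ, ‖𝓕 (fun x => Φ x * u x) ξ‖ₑ ^ 2 ≤
      m ^ 2 * ((∫⁻ η, w (η - ξ) * ENNReal.ofReal (pAbs s e₁ e₂ η)⁻¹) *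
        ∫⁻ η, w (η - ξ) * P η) := by
    intro ξ
    rw [← mul_assoc, ← lintegral_const_mul (m ^ 2) (by fun_prop)]
    refine le_trans (pow_le_pow_left₀ zero_le ?_ 2) (sq_lintegral_le_mul_of_sq_le
      (A := fun η => m ^ 2 * (w (η - ξ) * ENNReal.ofReal (pAbs s e₁ e₂ η)⁻¹))
      (B := fun η => w (η - ξ) * P η)
      (G := fun η => m * w (η - ξ) * ‖𝓕 (⇑u) η‖ₑ) (by fun_prop) (by fun_prop) ?_)
    · rw [SchwartzMap.fourier_mul_eq_integral]
      refine (enorm_integral_le_lintegral_enorm _).trans (lintegral_mono fun η => ?_)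
      simp only [enorm_mul]
      gcongr
      simpa using hΦ (η - ξ)
    · filter_upwards [ae_pAbs_pos (e₂ := e₂) (zero_lt_one.trans_le hs).ne'
        (norm_ne_zero_iff.1 (h1.trans_ne one_ne_zero))] with η hη
      refine le_of_eq ?_
      have : ENNReal.ofReal (pAbs s e₁ e₂ η)⁻¹ * ENNReal.ofReal (pAbs s e₁ e₂ η) = 1 := by
        rw [← ENNReal.ofReal_mul (by positivity), inv_mul_cancel₀ hη.ne', ENNReal.ofReal_one]
      calc _ = m ^ 2 * w (η - ξ) ^ 2 * ‖𝓕 (⇑u) η‖ₑ ^ 2 * 1 := by ring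
        _ = _ := by rw [← this, hP]; ring
  have hmain : ∫⁻ ξ, ENNReal.ofReal (√(1 + ‖ξ‖ ^ 2) * ‖𝓕 (fun x => Φ x * u x) ξ‖ ^ 2) ≤
      D * ∫⁻ η, P η := by
    calc _ ≤ ∫⁻ ξ, m ^ 2 * K * ∫⁻ η, w (η - ξ) * P η := by
          refine lintegral_mono fun ξ => ?_
          simp only
          rw [ENNReal.ofReal_mul (by positivity), ENNReal.ofReal_pow (norm_nonneg _), ofReal_norm]
          grw [hconv ξ, ← hK s hs e₁ e₂ h1 h2 h12 ξ]
          exact le_of_eq (by ring)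
      _ = m ^ 2 * K * ∫⁻ η, ∫⁻ ξ, w (η - ξ) * P η := by
          rw [lintegral_const_mul' _ _ (by finiteness), lintegral_lintegral_swap]
          exact Measurable.aemeasurable (by fun_prop)
      _ = _ := by
          have : ∀ η, ∫⁻ ξ, w (η - ξ) * P η = I * P η := fun η => by
            rw [lintegral_mul_const _ (by fun_prop), lintegral_sub_left_eq_self w η]
          simp_rw [this]
          rw [lintegral_const_mul _ hPm, hD]
          ring
  have hPt : ∫⁻ η, P η ≠ ⊤ := by
    simp_rw [← hPR]
    exact hint.lintegral_lt_top.ne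
  have hR : ∫ ξ, pAbs s e₁ e₂ ξ * ‖𝓕 (⇑u) ξ‖ ^ 2 = (∫⁻ η, P η).toReal := by
    rw [integral_eq_lintegral_of_nonneg_ae
      (Filter.Eventually.of_forall fun ξ => mul_nonneg (hp0 ξ) (by positivity))
      hint.aestronglyMeasurable]
    simp_rw [hPR]
  rw [hR]
  have hL : ∫ ξ, √(1 + ‖ξ‖ ^ 2) * ‖𝓕 (fun x => Φ x * u x) ξ‖ ^ 2 ≤
      (∫⁻ ξ, ENNReal.ofReal (√(1 + ‖ξ‖ ^ 2) * ‖𝓕 (fun x => Φ x * u x) ξ‖ ^ 2)).toReal := by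
    by_cases hi : Integrable fun ξ => √(1 + ‖ξ‖ ^ 2) * ‖𝓕 (fun x => Φ x * u x) ξ‖ ^ 2
    · exact (integral_eq_lintegral_of_nonneg_ae
        (Filter.Eventually.of_forall fun ξ => by positivity) hi.aestronglyMeasurable).le
    · rw [integral_undef hi]
      exact ENNReal.toReal_nonneg
  calc _ ≤ _ := hL
    _ ≤ (D * ∫⁻ η, P η).toReal := ENNReal.toReal_mono (by finiteness) hmain
    _ = D.toReal * (∫⁻ η, P η).toReal := ENNReal.toReal_mul
    _ ≤ _ := by gcongr; linarith
end
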